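/- arXiv:2307.08833 — 4 statements merged into one kernel-verified Lean document; each statement's English description precedes it below -/
import Mathlib

section
/- The output of every global algorithm on the string w is isomorphic to the grammar G_{{1,…,|V|}}. -/
/-- A straight-line grammar (SLG) over terminal alphabet `T` with set of nonterminals `N`:
every nonterminal has exactly one production rule (symbols are `N ⊕ T`). -/
structure SLG (T : Type) (N : Type) where
  start : N
  rhs : N → List (N ⊕ T)

namespace SLG

variable {T N : Type}

/-- One rewriting step: replace one occurrence of a nonterminal by its right-hand side. -/
def Produces (G : SLG T N) (x y : List (N ⊕ T)) : Prop :=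
  ∃ (p q : List (N ⊕ T)) (X : N),
    x = p ++ Sum.inl X :: q ∧ y = p ++ G.rhs X ++ q

/-- The derivation relation of an SLG. -/
def Derives (G : SLG T N) : List (N ⊕ T) → List (N ⊕ T) → Prop :=
  Relation.ReflTransGen G.Produces

/-- `u` is the (necessarily unique) expansion `exp_G(X)` of the nonterminal `X`. -/
def IsExp (G : SLG T N) (X : N) (u : List T) : Prop :=
  G.Derives [Sum.inl X] (u.map Sum.inr)

/-- The language of an SLG; for an SLG it equals `{exp_G(S)}`. -/
def language (G : SLG T N) : Set (List T) :=
  { u | G.IsExp G.start u }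

/-- `Y` occurs in the parse tree of `X`. -/
def Reaches (G : SLG T N) : N → N → Prop :=
  Relation.ReflTransGen (fun X Y => Sum.inl Y ∈ G.rhs X)

/-- An SLG is admissible if every right-hand side consists of exactly two symbols and
every nonterminal occurs in the parse tree of the start symbol. -/
def Admissible (G : SLG T N) : Prop :=
  (∀ X, (G.rhs X).length = 2) ∧ (∀ X, G.Reaches G.start X)

/-- The size of an SLG: the total length of the right-hand sides of all its rules. -/
def size (G : SLG T N) [Fintype N] : ℕ :=
  ∑ X : N, (G.rhs X).length

end SLG

section Alpha

variable {T N : Type} {n : ℕ}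

/-- The auxiliary grammar `G'` over `Σ' = Σ ∪ {$_i : i ∈ [1..|V|]}` (modelled as `T ⊕ Fin n`):
the rule `N_i → A B` of `G` becomes `N_i → A $_i B`, where `N_i = e i`. -/
def SLG.primed (G : SLG T N) (e : Fin n ≃ N) : SLG (T ⊕ Fin n) N where
  start := G.start
  rhs X :=
    match G.rhs X with
    | [A, B] =>
        [Sum.map id Sum.inl A, Sum.inr (Sum.inr (e.symm X)), Sum.map id Sum.inl B]
    | l => l.map (Sum.map id Sum.inl)

/-- The string `w ∈ α(G)` determined by the ordering `e` of the nonterminals and the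
`G'`-expansions `expD`, namely `w = ⨀_{i=1..|V|} exp_{G'}(N_i) · #_{2i-1} · exp_{G'}(N_i) · #_{2i}`,
over the alphabet `Σ'' = Σ ∪ {$_i : i ∈ [1..|V|]} ∪ {#_i : i ∈ [1..2|V|]}` (modelled as
`T ⊕ Fin n ⊕ Fin (2n)`). -/
def alphaWord (e : Fin n ≃ N) (expD : N → List (T ⊕ Fin n)) :
    List (T ⊕ Fin n ⊕ Fin (2 * n)) :=
  (List.finRange n).flatMap fun i =>
    (expD (e i)).map (Sum.map id Sum.inl)
      ++ Sum.inr (Sum.inr (⟨2 * i.val, by have := i.isLt; omega⟩ : Fin (2 * n)))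
      :: (expD (e i)).map (Sum.map id Sum.inl)
      ++ [Sum.inr (Sum.inr (⟨2 * i.val + 1, by have := i.isLt; omega⟩ : Fin (2 * n)))]

end Alpha

section Bexp

variable {T N : Type} {n : ℕ}

/-- The bounded expansion `bexp_I`, computed with explicit fuel (for an acyclic grammar
with `n` nonterminals, fuel `n` always suffices).  The output symbols are symbols of the
grammar `G_I`: its nonterminals are `Option {i // i ∈ I}` (`some i` is `M_i`, `none` is `S`)
and its terminals are `Σ'' = T ⊕ Fin n ⊕ Fin (2n)` (terminals of `G`, dollars, hashes). -/
def bexpFuel (G : SLG T N) (e : Fin n ≃ N) (I : Finset (Fin n)) :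
    ℕ → (N ⊕ T) → List ((Option {i : Fin n // i ∈ I}) ⊕ (T ⊕ Fin n ⊕ Fin (2 * n)))
  | _, Sum.inr t => [Sum.inr (Sum.inl t)]
  | 0, Sum.inl _ => []
  | k + 1, Sum.inl X =>
    if h : e.symm X ∈ I then [Sum.inl (some ⟨e.symm X, h⟩)]
    else
      match G.rhs X with
      | [A, B] =>
          bexpFuel G e I k A
            ++ Sum.inr (Sum.inr (Sum.inl (e.symm X))) :: bexpFuel G e I k B
      | _ => []

/-- `bexp_I` applied to a symbol of `G`. -/
def bexp (G : SLG T N) (e : Fin n ≃ N) (I : Finset (Fin n)) (s : N ⊕ T) :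
    List ((Option {i : Fin n // i ∈ I}) ⊕ (T ⊕ Fin n ⊕ Fin (2 * n))) :=
  bexpFuel G e I n s

/-- The grammar `G_I`: nonterminals `{S} ∪ {M_i : i ∈ I}`, rules
`M_i → bexp_I(X) $_i bexp_I(Y)` (where `N_i → X Y` in `G`) and
`S → ⨀_{i=1..|V|} bexp_I(N_i) · #_{2i-1} · bexp_I(N_i) · #_{2i}`. -/
def GI (G : SLG T N) (e : Fin n ≃ N) (I : Finset (Fin n)) :
    SLG (T ⊕ Fin n ⊕ Fin (2 * n)) (Option {i : Fin n // i ∈ I}) where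
  start := none
  rhs := fun
    | none => (List.finRange n).flatMap fun i =>
        bexp G e I (Sum.inl (e i))
          ++ Sum.inr (Sum.inr (Sum.inr (⟨2 * i.val, by have := i.isLt; omega⟩ : Fin (2 * n))))
          :: bexp G e I (Sum.inl (e i))
          ++ [Sum.inr (Sum.inr (Sum.inr
                (⟨2 * i.val + 1, by have := i.isLt; omega⟩ : Fin (2 * n))))]
    | some j =>
        match G.rhs (e j.1) with
        | [A, B] =>
            bexp G e I A ++ Sum.inr (Sum.inr (Sum.inl j.1)) :: bexp G e I B
        | _ => []

end Bexp

section Greedy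

variable {A B : Type}

/-- The number of non-overlapping occurrences of `p` in a list, found by the greedy
left-to-right scan (after finding an occurrence at position `i`, the search resumes at
position `i + |p|`). -/
def greedyCount [DecidableEq A] (p : List A) : List A → ℕ
  | [] => 0
  | a :: t =>
    if p ≠ [] ∧ p <+: (a :: t) then 1 + greedyCount p (t.drop (p.length - 1))
    else greedyCount p t
termination_by l => l.length
decreasing_by
  · simp only [List.length_drop, List.length_cons]; omega
  · simp only [List.length_cons]; omega

/-- Replace the greedily found non-overlapping occurrences of `p` in a list by the single
symbol `c`, mapping all remaining symbols by `f`. -/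
def greedyReplace [DecidableEq A] (p : List A) (c : B) (f : A → B) : List A → List B
  | [] => []
  | a :: t =>
    if p ≠ [] ∧ p <+: (a :: t) then c :: greedyReplace p c f (t.drop (p.length - 1))
    else f a :: greedyReplace p c f t
termination_by l => l.length
decreasing_by
  · simp only [List.length_drop, List.length_cons]; omega
  · simp only [List.length_cons]; omega

end Greedy

namespace SLG

variable {T N : Type}

/-- Total number of non-overlapping occurrences of the string `s` on the right-hand side
of the grammar `H` (greedy left-to-right scan of the definition of every nonterminal). -/
def rhsOccs [Fintype N] [DecidableEq N] [DecidableEq T] (H : SLG T N)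
    (s : List (N ⊕ T)) : ℕ :=
  ∑ X : N, greedyCount s (H.rhs X)

/-- `s` is a maximal string with respect to the grammar `H`: it has length at least two,
it has at least two non-overlapping occurrences on the right-hand side of `H`, and no
strictly longer string has at least as many non-overlapping occurrences. -/
def IsMaximal [Fintype N] [DecidableEq N] [DecidableEq T] (H : SLG T N)
    (s : List (N ⊕ T)) : Prop :=
  2 ≤ s.length ∧ 2 ≤ H.rhsOccs s ∧
    ∀ s' : List (N ⊕ T), s.length < s'.length → H.rhsOccs s' < H.rhsOccs s

/-- A single step of a global algorithm on `H` with chosen maximal string `s`: a fresh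
nonterminal (modelled by `none : Option N`) gets `s` as its definition, and the
non-overlapping occurrences of `s` (greedy left-to-right scan) on every right-hand side
are replaced by it. -/
def globalStep [DecidableEq N] [DecidableEq T] (H : SLG T N) (s : List (N ⊕ T)) :
    SLG T (Option N) where
  start := some H.start
  rhs := fun
    | some X => greedyReplace s (Sum.inl none) (Sum.map some id) (H.rhs X)
    | none => s.map (Sum.map some id)

/-- Isomorphism of SLGs over a common terminal alphabet: a bijection of the nonterminals
(extended by the identity on terminals) mapping start symbol to start symbol and the
right-hand side of every nonterminal symbol-by-symbol onto the right-hand side of its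
image. -/
def Isomorphic {N₁ N₂ : Type} (H₁ : SLG T N₁) (H₂ : SLG T N₂) : Prop :=
  ∃ g : N₁ ≃ N₂, g H₁.start = H₂.start ∧
    ∀ X, H₂.rhs (g X) = (H₁.rhs X).map (Sum.map g id)

/-- Renaming the nonterminals of an SLG along a bijection. -/
def relabel {N₁ N₂ : Type} (H : SLG T N₁) (g : N₁ ≃ N₂) : SLG T N₂ where
  start := g H.start
  rhs Y := (H.rhs (g.symm Y)).map (Sum.map g id)

end SLG

/-- The initial grammar of a global algorithm on the input string `w`: a single
nonterminal whose definition is `w`. -/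
def initSLG {T : Type} (w : List T) : SLG T (Fin 1) where
  start := 0
  rhs _ := w.map Sum.inr

/-- `Gs` is (the trace of) a run of `K` steps of a global algorithm on the input
string `w`: it starts with the one-rule grammar for `w` and each step replaces some
maximal string of the current grammar (after each step the nonterminals are renamed to
`Fin (k + 2)`, which keeps a uniform indexing and does not change the grammar up to
isomorphism). -/
def IsGlobalRun {T : Type} [DecidableEq T] (w : List T) (K : ℕ)
    (Gs : (k : ℕ) → SLG T (Fin (k + 1))) : Prop :=
  Gs 0 = initSLG w ∧
  ∀ k < K, ∃ s, (Gs k).IsMaximal s ∧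
    Gs (k + 1) = ((Gs k).globalStep s).relabel (finSuccEquiv (k + 1)).symm

namespace GlobalGrammar

section Greedy

variable {A B : Type} [DecidableEq A]

lemma greedyCount_le_count {s : List A} {d : A} (hd : d ∈ s) (x : List A) :
    greedyCount s x ≤ x.count d := by
  induction x using greedyCount.induct s with
  | case1 => simp [greedyCount]
  | case2 a t h ih =>
    rw [greedyCount, if_pos h]
    obtain ⟨r, hr⟩ := h.2
    have hdrop : t.drop (s.length - 1) = r := by
      cases s with
      | nil => simp at hd
      | cons b s =>
        simp only [List.cons_append, List.cons.injEq] at hr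
        simp [← hr.2]
    rw [hdrop] at ih ⊢
    rw [← hr, List.count_append]
    have := List.count_pos_iff.2 hd
    omega
  | case3 a t h ih =>
    rw [greedyCount, if_neg h]
    exact ih.trans (List.count_le_count_cons)

lemma infix_of_greedyCount_pos {s : List A} (x : List A) (h : 0 < greedyCount s x) :
    s <:+: x := by
  induction x using greedyCount.induct s with
  | case1 => simp [greedyCount] at h
  | case2 a t hp ih => exact hp.2.isInfix
  | case3 a t hp ih =>
    rw [greedyCount, if_neg hp] at h
    exact (ih h).trans (List.suffix_cons a t).isInfix

/-- `y` arises from `x` by replacing blocks `b` by `c` and mapping the other symbols by `f`,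
where all occurrences of the marker `d` in `x` lie in the replaced blocks. -/
inductive Replaces (b : List A) (d : A) (c : B) (f : A → B) : List A → List B → Prop
  | nil : Replaces b d c f [] []
  | symbol {a x y} : a ≠ d → Replaces b d c f x y → Replaces b d c f (a :: x) (f a :: y)
  | block {x y} : Replaces b d c f x y → Replaces b d c f (b ++ x) (c :: y)

variable {b : List A} {d : A} {c : B} {f : A → B}

omit [DecidableEq A] in
lemma Replaces.append {x x' : List A} {y y' : List B} (h : Replaces b d c f x y)
    (h' : Replaces b d c f x' y') : Replaces b d c f (x ++ x') (y ++ y') := by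
  induction h with
  | nil => exact h'
  | symbol ha _ ih => exact .symbol ha ih
  | block _ ih => rw [List.append_assoc]; exact .block ih

omit [DecidableEq A] in
lemma Replaces.single : Replaces b d c f b [c] := by
  simpa using (Replaces.block (.nil : Replaces b d c f [] []))

omit [DecidableEq A] in
lemma Replaces.of_not_mem {x : List A} (hx : d ∉ x) : Replaces b d c f x (x.map f) := by
  induction x with
  | nil => exact .nil
  | cons a x ih =>
    simp only [List.mem_cons, not_or] at hx
    exact .symbol (Ne.symm hx.1) (ih hx.2)

omit [DecidableEq A] in
lemma Replaces.flatMap {ι : Type} {F : ι → List A} {F' : ι → List B} (l : List ι)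
    (h : ∀ i, Replaces b d c f (F i) (F' i)) :
    Replaces b d c f (l.flatMap F) (l.flatMap F') := by
  induction l with
  | nil => exact .nil
  | cons i l ih => simpa using (h i).append ih

variable {u v : List A}

lemma Replaces.le_idxOf {x : List A} {y : List B} (hb : b = u ++ d :: v) (hu : d ∉ u)
    (h : Replaces b d c f x y) : d ∈ x → u.length ≤ x.idxOf d := by
  induction h with
  | nil => simp
  | symbol ha _ ih =>
    intro hd
    rw [List.idxOf_cons_ne _ ha]
    have := ih (by simpa [ha.symm] using hd)
    omega
  | block _ _ =>
    intro _
    rw [hb, List.append_assoc, List.idxOf_append_of_notMem hu]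
    omega

lemma Replaces.not_prefix {a : A} {x : List A} {y : List B} (hb : b = u ++ d :: v)
    (hu : d ∉ u) (ha : a ≠ d) (h : Replaces b d c f x y) : ¬ b <+: a :: x := by
  rintro ⟨r, hr⟩
  have hd : d ∈ x := by
    have : d ∈ a :: x := by rw [← hr, hb]; simp
    simpa [ha.symm] using this
  have h1 := h.le_idxOf hb hu hd
  have h2 := congrArg (List.idxOf d) hr
  rw [List.idxOf_cons_ne _ ha, hb, List.append_assoc, List.idxOf_append_of_notMem hu,
    List.cons_append, List.idxOf_cons_self] at h2
  omega

lemma greedyReplace_append (hb : b ≠ []) (x : List A) :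
    greedyReplace b c f (b ++ x) = c :: greedyReplace b c f x := by
  obtain ⟨a, b, rfl⟩ := List.exists_cons_of_ne_nil hb
  rw [List.cons_append, greedyReplace, if_pos ⟨hb, by simp⟩]
  simp

lemma greedyCount_append (hb : b ≠ []) (x : List A) :
    greedyCount b (b ++ x) = 1 + greedyCount b x := by
  obtain ⟨a, b, rfl⟩ := List.exists_cons_of_ne_nil hb
  rw [List.cons_append, greedyCount, if_pos ⟨hb, by simp⟩]
  simp

lemma Replaces.greedyReplace_eq {x : List A} {y : List B} (hb : b = u ++ d :: v)
    (hu : d ∉ u) (h : Replaces b d c f x y) : greedyReplace b c f x = y := by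
  induction h with
  | nil => simp [greedyReplace]
  | symbol ha h ih =>
    rw [greedyReplace, if_neg (fun hp => h.not_prefix hb hu ha hp.2), ih]
  | block _ ih => rw [greedyReplace_append (by simp [hb]), ih]

lemma Replaces.greedyCount_eq {x : List A} {y : List B} (hb : b = u ++ d :: v)
    (hu : d ∉ u) (hv : d ∉ v) (h : Replaces b d c f x y) :
    greedyCount b x = x.count d := by
  induction h with
  | nil => simp [greedyCount]
  | symbol ha h ih =>
    rw [greedyCount, if_neg (fun hp => h.not_prefix hb hu ha hp.2), ih,
      List.count_cons_of_ne ha]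
  | block _ ih =>
    have h1 : b.count d = 1 := by
      simp [hb, List.count_eq_zero_of_not_mem hu, List.count_eq_zero_of_not_mem hv]
    rw [greedyCount_append (by simp [hb]), ih, List.count_append, h1]

omit [DecidableEq A] in
lemma infix_or_infix_of_not_mem {s x y : List A} {d : A} (hd : d ∉ s)
    (h : s <:+: x ++ d :: y) : s <:+: x ∨ s <:+: y := by
  obtain ⟨p, q, h⟩ := h
  rw [List.append_assoc] at h
  rcases List.append_eq_append_iff.1 h with ⟨a, rfl, h₁⟩ | ⟨a, rfl, h₁⟩
  · rcases List.append_eq_append_iff.1 h₁ with ⟨a', rfl, h₂⟩ | ⟨a', rfl, h₂⟩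
    · exact .inl ⟨p, a', by simp⟩
    · cases a' with
      | nil => exact .inl ⟨p, [], by simp⟩
      | cons z a' =>
        simp only [List.cons_append, List.cons.injEq] at h₂
        exact absurd (by simp [h₂.1]) hd
  · cases a with
    | nil =>
      rw [List.nil_append] at h₁
      cases s with
      | nil => exact .inl (List.nil_infix)
      | cons z s =>
        simp only [List.cons_append, List.cons.injEq] at h₁
        exact absurd (by simp [h₁.1]) hd
    | cons z a =>
      simp only [List.cons_append, List.cons.injEq] at h₁
      exact .inr ⟨a, q, by simp [h₁.2]⟩

end Greedy

/-- Parse trees of a grammar with rules of length two, inner nodes labelled by the index of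
their nonterminal. -/
inductive ParseTree (T : Type) (n : ℕ) : Type
  | leaf : T → ParseTree T n
  | node : Fin n → ParseTree T n → ParseTree T n → ParseTree T n

namespace ParseTree

variable {T : Type} {n : ℕ}

/-- The number of nodes. -/
def size : ParseTree T n → ℕ
  | leaf _ => 1
  | node _ l r => l.size + r.size + 1

/-- `t.Has i` says that some inner node of `t` is labelled `i`. -/
def Has (i : Fin n) : ParseTree T n → Prop
  | leaf _ => False
  | node j l r => i = j ∨ l.Has i ∨ r.Has i

/-- Every subtree of `t` with root label `j` is the tree `τ j`. -/
def Coherent (τ : Fin n → ParseTree T n) : ParseTree T n → Prop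
  | leaf _ => True
  | node j l r => τ j = node j l r ∧ l.Coherent τ ∧ r.Coherent τ

/-- The in-order traversal of a tree. -/
def yield : ParseTree T n → List (T ⊕ Fin n)
  | leaf t => [Sum.inl t]
  | node i l r => l.yield ++ Sum.inr i :: r.yield

/-- The in-order traversal cut off at the nodes whose label is assigned a nonterminal
by `μ`. -/
def word {P : Type} (μ : Fin n → Option P) :
    ParseTree T n → List (P ⊕ (T ⊕ Fin n ⊕ Fin (2 * n)))
  | leaf t => [Sum.inr (Sum.inl t)]
  | node i l r =>
    match μ i with
    | some p => [Sum.inl p]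
    | none => l.word μ ++ Sum.inr (Sum.inr (Sum.inl i)) :: r.word μ

lemma size_le_of_has {τ : Fin n → ParseTree T n} {i : Fin n} {t : ParseTree T n}
    (h : t.Coherent τ) (hi : t.Has i) : (τ i).size ≤ t.size := by
  induction t with
  | leaf => exact hi.elim
  | node j l r ihl ihr =>
    obtain ⟨hj, hl, hr⟩ := h
    rcases hi with rfl | hi | hi
    · rw [hj]
    · have := ihl hl hi; simp only [size]; omega
    · have := ihr hr hi; simp only [size]; omega

lemma Coherent.not_has {τ : Fin n → ParseTree T n} {i : Fin n} {l r : ParseTree T n}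
    (h : (node i l r).Coherent τ) : ¬ l.Has i ∧ ¬ r.Has i := by
  obtain ⟨hi, hl, hr⟩ := h
  constructor <;> intro hh
  · have := size_le_of_has hl hh
    rw [hi, size] at this; omega
  · have := size_le_of_has hr hh
    rw [hi, size] at this; omega

section Word

variable {P : Type} {μ : Fin n → Option P} {τ : Fin n → ParseTree T n}

lemma word_node_none {i : Fin n} (h : μ i = none) (l r : ParseTree T n) :
    (node i l r).word μ = l.word μ ++ Sum.inr (Sum.inr (Sum.inl i)) :: r.word μ := by
  simp [word, h]

lemma word_node_some {i : Fin n} {p : P} (h : μ i = some p) (l r : ParseTree T n) :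
    (node i l r).word μ = [Sum.inl p] := by
  simp [word, h]

lemma dollar_mem_word {i : Fin n} {t : ParseTree T n}
    (h : Sum.inr (Sum.inr (Sum.inl i)) ∈ t.word μ) : t.Has i ∧ μ i = none := by
  induction t with
  | leaf => simp [word] at h
  | node j l r ihl ihr =>
    cases hj : μ j with
    | some p => simp [word_node_some hj] at h
    | none =>
      rw [word_node_none hj] at h
      simp only [List.mem_append, List.mem_cons, Sum.inr.injEq, Sum.inl.injEq] at h
      rcases h with h | rfl | h
      · exact ⟨.inr (.inl (ihl h).1), (ihl h).2⟩
      · exact ⟨.inl rfl, hj⟩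
      · exact ⟨.inr (.inr (ihr h).1), (ihr h).2⟩

lemma hash_not_mem_word (h : Fin (2 * n)) (t : ParseTree T n) :
    Sum.inr (Sum.inr (Sum.inr h)) ∉ t.word μ := by
  induction t with
  | leaf => simp [word]
  | node j l r ihl ihr =>
    cases hj : μ j with
    | some p => simp [word_node_some hj]
    | none => simp [word_node_none hj, ihl, ihr]

lemma word_map {Q : Type} (g : P → Q) (t : ParseTree T n) :
    t.word (fun i => (μ i).map g) = (t.word μ).map (Sum.map g id) := by
  induction t with
  | leaf => simp [word]
  | node j l r ihl ihr =>
    cases hj : μ j with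
    | some p =>
      rw [word_node_some hj, word_node_some (p := g p) (by simp [hj])]; simp
    | none =>
      rw [word_node_none hj, word_node_none (by simp [hj]), ihl, ihr]; simp

lemma word_none (t : ParseTree T n) :
    t.word (fun _ => (none : Option P)) =
      (t.yield.map (Sum.map id Sum.inl)).map Sum.inr := by
  induction t with
  | leaf => simp [word, yield]
  | node j l r ihl ihr => rw [word_node_none rfl, ihl, ihr]; simp [yield]

/-- A string of length at least two inside a truncated tree, avoiding the markers of
truncated labels, lies in the truncated tree of one of the markers it contains. -/
lemma exists_infix_word {s : List (P ⊕ (T ⊕ Fin n ⊕ Fin (2 * n)))} (hs : 2 ≤ s.length)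
    {t : ParseTree T n} (ht : t.Coherent τ) (h : s <:+: t.word μ) :
    ∃ i, μ i = none ∧ Sum.inr (Sum.inr (Sum.inl i)) ∈ s ∧ s <:+: (τ i).word μ := by
  induction t with
  | leaf => have := h.length_le; simp [word] at this; omega
  | node j l r ihl ihr =>
    obtain ⟨hj, hl, hr⟩ := ht
    cases hμ : μ j with
    | some p => have := h.length_le; simp [word_node_some hμ] at this; omega
    | none =>
      by_cases hd : Sum.inr (Sum.inr (Sum.inl j)) ∈ s
      · exact ⟨j, hμ, hd, hj ▸ h⟩
      · rw [word_node_none hμ] at h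
        rcases infix_or_infix_of_not_mem hd h with h | h
        · exact ihl hl h
        · exact ihr hr h

/-- The assignment `μ` extended by a fresh nonterminal `none` for the label `i`. -/
def extend (μ : Fin n → Option P) (i : Fin n) : Fin n → Option (Option P) :=
  Function.update (fun j => (μ j).map some) i (some none)

lemma word_extend_of_not_has {i : Fin n} {t : ParseTree T n} (h : ¬ t.Has i) :
    t.word (extend μ i) = (t.word μ).map (Sum.map some id) := by
  induction t with
  | leaf => simp [word]
  | node j l r ihl ihr =>
    simp only [Has, not_or] at h
    have hji : j ≠ i := Ne.symm h.1
    cases hj : μ j with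
    | some p =>
      rw [word_node_some hj, word_node_some (p := some p) (by simp [extend, hji, hj])]; simp
    | none =>
      rw [word_node_none hj, word_node_none (by simp [extend, hji, hj]), ihl h.2.1, ihr h.2.2]
      simp

lemma replaces_word [DecidableEq T] [DecidableEq P] {i : Fin n} (hi : μ i = none)
    {t : ParseTree T n} (ht : t.Coherent τ) :
    Replaces ((τ i).word μ) (Sum.inr (Sum.inr (Sum.inl i))) (Sum.inl none)
      (Sum.map some id) (t.word μ) (t.word (extend μ i)) := by
  induction t with
  | leaf => exact .symbol (by simp) .nil
  | node j l r ihl ihr =>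
    obtain ⟨hj, hl, hr⟩ := ht
    by_cases hji : j = i
    · subst hji
      rw [word_node_some (p := none) (by simp [extend]), ← hj]
      exact .single
    · cases hμ : μ j with
      | some p =>
        rw [word_node_some hμ, word_node_some (p := some p) (by simp [extend, hji, hμ])]
        exact .symbol (by simp) .nil
      | none =>
        rw [word_node_none hμ, word_node_none (by simp [extend, hji, hμ])]
        exact (ihl hl).append (.symbol (by simpa using hji) (ihr hr))

end Word

end ParseTree

open ParseTree

section Invariant

variable {T P : Type} {n : ℕ}

/-- The right-hand side of the start symbol. -/
def startText (τ : Fin n → ParseTree T n) (μ : Fin n → Option P) :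
    List (P ⊕ (T ⊕ Fin n ⊕ Fin (2 * n))) :=
  (List.finRange n).flatMap fun i =>
    (τ i).word μ
      ++ Sum.inr (Sum.inr (Sum.inr (⟨2 * i.val, by have := i.isLt; omega⟩ : Fin (2 * n))))
      :: (τ i).word μ
      ++ [Sum.inr (Sum.inr (Sum.inr (⟨2 * i.val + 1, by have := i.isLt; omega⟩ : Fin (2 * n))))]

/-- `H` is the grammar `G_I`, where `I` is the set of labels to which `μ` assigns a
nonterminal, up to the names of the nonterminals. -/
structure IsPartial (τ L R : Fin n → ParseTree T n) (H : SLG (T ⊕ Fin n ⊕ Fin (2 * n)) P)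
    (μ : Fin n → Option P) : Prop where
  rhs_start : H.rhs H.start = startText τ μ
  ne_start : ∀ i p, μ i = some p → p ≠ H.start
  rhs_some : ∀ i p, μ i = some p →
    H.rhs p = (L i).word μ ++ Sum.inr (Sum.inr (Sum.inl i)) :: (R i).word μ
  inj : ∀ i j p, μ i = some p → μ j = some p → i = j
  surj : ∀ p, p = H.start ∨ ∃ i, μ i = some p

variable {τ L R : Fin n → ParseTree T n} {H : SLG (T ⊕ Fin n ⊕ Fin (2 * n)) P}
  {μ : Fin n → Option P}

lemma startText_map {Q : Type} (g : P → Q) :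
    startText τ (fun i => (μ i).map g) = (startText τ μ).map (Sum.map g id) := by
  simp [startText, word_map, List.map_flatMap]

lemma IsPartial.relabel {Q : Type} (h : IsPartial τ L R H μ) (g : P ≃ Q) :
    IsPartial τ L R (H.relabel g) (fun i => (μ i).map g) where
  rhs_start := by simp [SLG.relabel, h.rhs_start, startText_map]
  ne_start i q hq := by
    obtain ⟨p, hp, rfl⟩ := Option.map_eq_some_iff.1 hq
    simpa [SLG.relabel] using h.ne_start i p hp
  rhs_some i q hq := by
    obtain ⟨p, hp, rfl⟩ := Option.map_eq_some_iff.1 hq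
    simp [SLG.relabel, h.rhs_some i p hp, word_map]
  inj i j q hi hj := by
    obtain ⟨p, hp, rfl⟩ := Option.map_eq_some_iff.1 hi
    obtain ⟨p', hp', he⟩ := Option.map_eq_some_iff.1 hj
    exact h.inj i j p hp (by rw [hp', g.injective he])
  surj q := by
    rcases h.surj (g.symm q) with hq | ⟨i, hi⟩
    · exact .inl (by simp [SLG.relabel, ← hq])
    · exact .inr ⟨i, by simp [hi]⟩

variable [DecidableEq T] [DecidableEq P]

/-- Boolean equality on sums from decidable equality, so that `List.count` is lawful. -/
local instance sumBEq {A B : Type} [DecidableEq A] [DecidableEq B] :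
    BEq (A ⊕ B) := instBEqOfDecidableEq

local instance sumLawfulBEq {A B : Type} [DecidableEq A] [DecidableEq B] :
    LawfulBEq (A ⊕ B) := inferInstanceAs (@LawfulBEq (A ⊕ B) instBEqOfDecidableEq)

lemma replaces_startText (hτ : ∀ i, (τ i).Coherent τ) {i : Fin n} (hi : μ i = none) :
    Replaces ((τ i).word μ) (Sum.inr (Sum.inr (Sum.inl i))) (Sum.inl none)
      (Sum.map some id) (startText τ μ) (startText τ (extend μ i)) :=
  Replaces.flatMap _ fun j =>
    ((replaces_word hi (hτ j)).append
      (.symbol (by simp) (replaces_word hi (hτ j)))).append (.symbol (by simp) .nil)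

lemma replaces_rule (hnode : ∀ i, τ i = node i (L i) (R i)) (hτ : ∀ i, (τ i).Coherent τ)
    {i j : Fin n} (hi : μ i = none) (hij : j ≠ i) :
    Replaces ((τ i).word μ) (Sum.inr (Sum.inr (Sum.inl i))) (Sum.inl none)
      (Sum.map some id)
      ((L j).word μ ++ Sum.inr (Sum.inr (Sum.inl j)) :: (R j).word μ)
      ((L j).word (extend μ i) ++ Sum.inr (Sum.inr (Sum.inl j)) :: (R j).word (extend μ i)) := by
  have hj := hτ j
  rw [hnode j] at hj
  exact (replaces_word hi hj.2.1).append (.symbol (by simpa using hij) (replaces_word hi hj.2.2))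

omit [DecidableEq T] [DecidableEq P] in
lemma not_has_children (hnode : ∀ i, τ i = node i (L i) (R i))
    (hτ : ∀ i, (τ i).Coherent τ) (i : Fin n) : ¬ (L i).Has i ∧ ¬ (R i).Has i :=
  Coherent.not_has (hnode i ▸ hτ i)

lemma IsPartial.globalStep (hnode : ∀ i, τ i = node i (L i) (R i))
    (hτ : ∀ i, (τ i).Coherent τ) (h : IsPartial τ L R H μ) {i : Fin n} (hi : μ i = none) :
    IsPartial τ L R (H.globalStep ((τ i).word μ)) (extend μ i) := by
  have hb : (τ i).word μ = (L i).word μ ++ Sum.inr (Sum.inr (Sum.inl i)) :: (R i).word μ := by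
    rw [hnode i, word_node_none hi]
  obtain ⟨hL, hR⟩ := not_has_children hnode hτ i
  have hu : Sum.inr (Sum.inr (Sum.inl i)) ∉ (L i).word μ := fun hm => hL (dollar_mem_word hm).1
  have hext : ∀ j p, extend μ i j = some p →
      (j = i ∧ p = none) ∨ (j ≠ i ∧ ∃ q, μ j = some q ∧ p = some q) := by
    intro j p hp
    by_cases hj : j = i
    · subst hj
      exact .inl ⟨rfl, by simpa [extend, eq_comm] using hp⟩
    · simp only [extend, ne_eq, hj, not_false_eq_true, Function.update_of_ne,
        Option.map_eq_some_iff] at hp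
      obtain ⟨q, hq, rfl⟩ := hp
      exact .inr ⟨hj, q, hq, rfl⟩
  refine ⟨?_, ?_, ?_, ?_, ?_⟩
  · change greedyReplace _ _ _ (H.rhs H.start) = _
    rw [h.rhs_start]
    exact (replaces_startText hτ hi).greedyReplace_eq hb hu
  · intro j p hp
    rcases hext j p hp with ⟨rfl, rfl⟩ | ⟨_, q, hq, rfl⟩
    · simp [SLG.globalStep]
    · simpa [SLG.globalStep] using h.ne_start j q hq
  · intro j p hp
    rcases hext j p hp with ⟨rfl, rfl⟩ | ⟨hj, q, hq, rfl⟩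
    · change ((τ j).word μ).map _ = _
      rw [hb, word_extend_of_not_has hL, word_extend_of_not_has hR]
      simp
    · change greedyReplace _ _ _ (H.rhs q) = _
      rw [h.rhs_some j q hq]
      exact (replaces_rule hnode hτ hi hj).greedyReplace_eq hb hu
  · intro j k p hj hk
    rcases hext j p hj with ⟨rfl, rfl⟩ | ⟨_, q, hq, rfl⟩
    · rcases hext k _ hk with ⟨rfl, _⟩ | ⟨_, q, _, hn⟩
      · rfl
      · simp at hn
    · rcases hext k _ hk with ⟨_, hn⟩ | ⟨_, q', hq', hn⟩
      · simp at hn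
      · obtain rfl := Option.some.inj hn
        exact h.inj j k q hq hq'
  · rintro (_ | p)
    · exact .inr ⟨i, by simp [extend]⟩
    · rcases h.surj p with rfl | ⟨j, hj⟩
      · exact .inl rfl
      · have hji : j ≠ i := by rintro rfl; simp [hi] at hj
        exact .inr ⟨j, by simp [extend, hji, hj]⟩

variable [Fintype P]

lemma IsPartial.rhsOccs_word (hnode : ∀ i, τ i = node i (L i) (R i))
    (hτ : ∀ i, (τ i).Coherent τ) (h : IsPartial τ L R H μ) {i : Fin n} (hi : μ i = none) :
    H.rhsOccs ((τ i).word μ) =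
      ∑ X : P, (H.rhs X).count (Sum.inr (Sum.inr (Sum.inl i))) := by
  have hb : (τ i).word μ = (L i).word μ ++ Sum.inr (Sum.inr (Sum.inl i)) :: (R i).word μ := by
    rw [hnode i, word_node_none hi]
  obtain ⟨hL, hR⟩ := not_has_children hnode hτ i
  have hu : Sum.inr (Sum.inr (Sum.inl i)) ∉ (L i).word μ := fun hm => hL (dollar_mem_word hm).1
  have hv : Sum.inr (Sum.inr (Sum.inl i)) ∉ (R i).word μ := fun hm => hR (dollar_mem_word hm).1
  refine Finset.sum_congr rfl fun X _ => ?_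
  rcases h.surj X with rfl | ⟨j, hj⟩
  · rw [h.rhs_start]
    exact (replaces_startText hτ hi).greedyCount_eq hb hu hv
  · rw [h.rhs_some j X hj]
    have hji : j ≠ i := by rintro rfl; simp [hi] at hj
    exact (replaces_rule hnode hτ hi hji).greedyCount_eq hb hu hv

lemma rhsOccs_le_sum_count {H : SLG (T ⊕ Fin n ⊕ Fin (2 * n)) P}
    {s : List (P ⊕ (T ⊕ Fin n ⊕ Fin (2 * n)))}
    {d : P ⊕ (T ⊕ Fin n ⊕ Fin (2 * n))} (hd : d ∈ s) :
    H.rhsOccs s ≤ ∑ X : P, (H.rhs X).count d :=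
  Finset.sum_le_sum fun _ _ => greedyCount_le_count hd _

lemma IsPartial.count_hash (h : IsPartial τ L R H μ) (k : Fin (2 * n)) :
    ∑ X : P, (H.rhs X).count (Sum.inr (Sum.inr (Sum.inr k))) ≤ 1 := by
  rw [Finset.sum_eq_single H.start]
  · have hk := k.isLt
    rw [h.rhs_start, startText, List.count_flatMap]
    have hlist : ∀ f : Fin n → ℕ, ((List.finRange n).map f).sum = ∑ i, f i := fun f => by
      rw [Fin.sum_univ_def]
    rw [hlist, Finset.sum_eq_single (⟨k.val / 2, by omega⟩ : Fin n)]
    · simp only [Function.comp_apply, List.count_append, List.count_cons, List.count_nil,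
        List.count_eq_zero_of_not_mem (hash_not_mem_word k _), beq_iff_eq, Sum.inr.injEq,
        Fin.ext_iff]
      split_ifs <;> omega
    · intro i _ hi
      simp only [ne_eq, Fin.ext_iff] at hi
      simp only [Function.comp_apply, List.count_append, List.count_cons, List.count_nil,
        List.count_eq_zero_of_not_mem (hash_not_mem_word k _), beq_iff_eq, Sum.inr.injEq,
        Fin.ext_iff]
      split_ifs <;> omega
    · simp
  · intro X _ hX
    rcases h.surj X with rfl | ⟨j, hj⟩
    · exact absurd rfl hX
    · rw [h.rhs_some j X hj]
      exact List.count_eq_zero_of_not_mem (by simp [hash_not_mem_word])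
  · simp

lemma IsPartial.count_dollar (h : IsPartial τ L R H μ) {j : Fin n} {p : P} (hj : μ j = some p) :
    ∑ X : P, (H.rhs X).count (Sum.inr (Sum.inr (Sum.inl j))) ≤ 1 := by
  have hw : ∀ t : ParseTree T n, Sum.inr (Sum.inr (Sum.inl j)) ∉ t.word μ := fun t ht => by
    have := (dollar_mem_word ht).2
    simp [hj] at this
  rw [Finset.sum_eq_single p]
  · rw [h.rhs_some j p hj]
    simp [List.count_eq_zero_of_not_mem (hw _)]
  · intro X _ hX
    apply List.count_eq_zero_of_not_mem
    rcases h.surj X with rfl | ⟨k, hk⟩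
    · rw [h.rhs_start, startText]
      simp [hw]
    · rw [h.rhs_some k X hk]
      have : j ≠ k := by
        rintro rfl
        exact hX (Option.some.inj (hk.symm.trans hj))
      simp [hw, this]
  · simp

omit [DecidableEq T] [DecidableEq P] [Fintype P] in
lemma exists_infix_of_infix_startText {s : List (P ⊕ (T ⊕ Fin n ⊕ Fin (2 * n)))}
    (hs : 2 ≤ s.length) (hh : ∀ k, Sum.inr (Sum.inr (Sum.inr k)) ∉ s)
    (h : s <:+: startText τ μ) : ∃ i, s <:+: (τ i).word μ := by
  unfold startText at h
  generalize List.finRange n = l at h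
  induction l with
  | nil => have := h.length_le; rw [List.flatMap_nil, List.length_nil] at this; omega
  | cons i l ih =>
    rw [List.flatMap_cons, List.append_assoc, List.append_assoc, List.cons_append] at h
    rcases infix_or_infix_of_not_mem (hh _) h with h | h
    · exact ⟨i, h⟩
    · rw [List.singleton_append] at h
      rcases infix_or_infix_of_not_mem (hh _) h with h | h
      · exact ⟨i, h⟩
      · exact ih h

lemma IsPartial.eq_word_of_isMaximal (hnode : ∀ i, τ i = node i (L i) (R i))
    (hτ : ∀ i, (τ i).Coherent τ) (h : IsPartial τ L R H μ)
    {s : List (P ⊕ (T ⊕ Fin n ⊕ Fin (2 * n)))} (hs : H.IsMaximal s) :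
    ∃ i, μ i = none ∧ s = (τ i).word μ := by
  obtain ⟨hlen, hocc, hmax⟩ := hs
  have hhash : ∀ k, Sum.inr (Sum.inr (Sum.inr k)) ∉ s := fun k hk => by
    have := (rhsOccs_le_sum_count (H := H) hk).trans (h.count_hash k)
    omega
  obtain ⟨X, hX⟩ : ∃ X, 0 < greedyCount s (H.rhs X) := by
    by_contra! hne
    have : H.rhsOccs s = 0 := Finset.sum_eq_zero fun X _ => by simpa using hne X
    omega
  have hinf := infix_of_greedyCount_pos _ hX
  obtain ⟨t, ht, hst⟩ : ∃ t : ParseTree T n, t.Coherent τ ∧ s <:+: t.word μ := by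
    rcases h.surj X with rfl | ⟨j, hj⟩
    · rw [h.rhs_start] at hinf
      obtain ⟨i, hi⟩ := exists_infix_of_infix_startText hlen hhash hinf
      exact ⟨τ i, hτ i, hi⟩
    · have hd : Sum.inr (Sum.inr (Sum.inl j)) ∉ s := fun hd => by
        have := (rhsOccs_le_sum_count (H := H) hd).trans (h.count_dollar hj)
        omega
      have hc := hτ j
      rw [hnode j] at hc
      rw [h.rhs_some j X hj] at hinf
      rcases infix_or_infix_of_not_mem hd hinf with hi | hi
      · exact ⟨L j, hc.2.1, hi⟩
      · exact ⟨R j, hc.2.2, hi⟩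
  obtain ⟨i, hi, hd, hsi⟩ := exists_infix_word hlen ht hst
  refine ⟨i, hi, hsi.eq_of_length_le ?_⟩
  by_contra! hlt
  have h1 := hmax _ hlt
  rw [h.rhsOccs_word hnode hτ hi] at h1
  exact absurd (rhsOccs_le_sum_count (H := H) hd) (by omega)

lemma exists_isMaximal {H : SLG (T ⊕ Fin n ⊕ Fin (2 * n)) P}
    {s : List (P ⊕ (T ⊕ Fin n ⊕ Fin (2 * n)))} (hlen : 2 ≤ s.length) (hocc : 2 ≤ H.rhsOccs s) :
    ∃ s', H.IsMaximal s' := by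
  let S : Set ℕ := {l | ∃ s', s'.length = l ∧ 2 ≤ s'.length ∧ 2 ≤ H.rhsOccs s'}
  have hne : S.Nonempty := ⟨_, s, rfl, hlen, hocc⟩
  have hbdd : BddAbove S := by
    refine ⟨∑ X : P, (H.rhs X).length, ?_⟩
    rintro _ ⟨s', rfl, -, ho⟩
    obtain ⟨X, hX⟩ : ∃ X, 0 < greedyCount s' (H.rhs X) := by
      by_contra! hne
      have : H.rhsOccs s' = 0 := Finset.sum_eq_zero fun X _ => by simpa using hne X
      omega
    exact (infix_of_greedyCount_pos _ hX).length_le.trans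
      (Finset.single_le_sum (f := fun X => (H.rhs X).length) (fun _ _ => Nat.zero_le _)
        (Finset.mem_univ X))
  obtain ⟨s', hl, h2, ho⟩ := Nat.sSup_mem hne hbdd
  refine ⟨s', h2, ho, fun s'' hlt => ?_⟩
  by_contra! hge
  have : s''.length ≤ sSup S := le_csSup hbdd ⟨s'', rfl, by omega, by omega⟩
  omega

lemma IsPartial.exists_isMaximal (hnode : ∀ i, τ i = node i (L i) (R i))
    (hτ : ∀ i, (τ i).Coherent τ) (h : IsPartial τ L R H μ) {i : Fin n} (hi : μ i = none) :
    ∃ s, H.IsMaximal s := by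
  have hb : (τ i).word μ = (L i).word μ ++ Sum.inr (Sum.inr (Sum.inl i)) :: (R i).word μ := by
    rw [hnode i, word_node_none hi]
  have hpos : ∀ t : ParseTree T n, 0 < (t.word μ).length := by
    intro t
    cases t with
    | leaf => simp [word]
    | node j l r => cases hj : μ j <;> simp [word, hj]
  have hcount : 1 ≤ ((τ i).word μ).count (Sum.inr (Sum.inr (Sum.inl i))) :=
    List.count_pos_iff.2 (by simp [hb])
  refine GlobalGrammar.exists_isMaximal (s := (τ i).word μ) ?_ ?_
  · have := hpos (L i)
    simp only [hb, List.length_append, List.length_cons]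
    omega
  · rw [h.rhsOccs_word hnode hτ hi]
    refine le_trans ?_ (Finset.single_le_sum
      (f := fun X => (H.rhs X).count (Sum.inr (Sum.inr (Sum.inl i))))
      (fun _ _ => Nat.zero_le _) (Finset.mem_univ H.start))
    simp only [h.rhs_start, startText, List.count_flatMap]
    refine le_trans ?_ (List.single_le_sum (fun _ _ => Nat.zero_le _) _
      (List.mem_map_of_mem (List.mem_finRange i)))
    simp only [Function.comp_apply, List.count_append, List.count_cons]
    omega

end Invariant

section Grammar

variable {T N : Type} {n : ℕ}

/-- `t` is the parse tree of the symbol `x`. -/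
inductive IsParseTree (e : Fin n ≃ N) (G : SLG T N) : N ⊕ T → ParseTree T n → Prop
  | leaf (t : T) : IsParseTree e G (Sum.inr t) (.leaf t)
  | node {X : N} {A B : N ⊕ T} {l r : ParseTree T n} : G.rhs X = [A, B] →
      IsParseTree e G A l → IsParseTree e G B r →
      IsParseTree e G (Sum.inl X) (.node (e.symm X) l r)

/-- The word `x` over the symbols of `G'` expands to `u` via parse trees of `G`. -/
inductive Expands (e : Fin n ≃ N) (G : SLG T N) :
    List (N ⊕ (T ⊕ Fin n)) → List (T ⊕ Fin n) → Prop
  | nil : Expands e G [] []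
  | terminal {x u} (a : T ⊕ Fin n) : Expands e G x u → Expands e G (Sum.inr a :: x) (a :: u)
  | nonterminal {X t x u} : IsParseTree e G (Sum.inl X) t → Expands e G x u →
      Expands e G (Sum.inl X :: x) (t.yield ++ u)

variable {e : Fin n ≃ N} {G : SLG T N}

lemma IsParseTree.unique {x : N ⊕ T} {t t' : ParseTree T n} (h : IsParseTree e G x t)
    (h' : IsParseTree e G x t') : t = t' := by
  induction h generalizing t' with
  | leaf t => cases h'; rfl
  | node hX _ _ ihA ihB =>
    cases h' with
    | node hX' hA' hB' =>
      rw [hX] at hX'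
      simp only [List.cons.injEq, and_true] at hX'
      obtain ⟨rfl, rfl⟩ := hX'
      rw [ihA hA', ihB hB']

lemma IsParseTree.coherent {t : N → ParseTree T n} (ht : ∀ X, IsParseTree e G (Sum.inl X) (t X))
    {x : N ⊕ T} {t' : ParseTree T n} (h : IsParseTree e G x t') :
    t'.Coherent (fun i => t (e i)) := by
  induction h with
  | leaf => trivial
  | node hX hA hB ihA ihB =>
    refine ⟨?_, ihA, ihB⟩
    simpa using (ht _).unique (.node hX hA hB)

lemma expands_map_inr (u : List (T ⊕ Fin n)) : Expands e G (u.map Sum.inr) u := by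
  induction u with
  | nil => exact .nil
  | cons a u ih => exact .terminal a ih

lemma Expands.append {x y : List (N ⊕ (T ⊕ Fin n))} {u v : List (T ⊕ Fin n)}
    (hx : Expands e G x u) (hy : Expands e G y v) : Expands e G (x ++ y) (u ++ v) := by
  induction hx with
  | nil => exact hy
  | terminal a _ ih => exact .terminal a ih
  | nonterminal ht _ ih => rw [List.append_assoc]; exact .nonterminal ht ih

lemma Expands.split {x y : List (N ⊕ (T ⊕ Fin n))} {w : List (T ⊕ Fin n)}
    (h : Expands e G (x ++ y) w) :
    ∃ u v, w = u ++ v ∧ Expands e G x u ∧ Expands e G y v := by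
  induction x generalizing w with
  | nil => exact ⟨[], w, rfl, .nil, h⟩
  | cons a x ih =>
    cases h with
    | terminal a h =>
      obtain ⟨u, v, rfl, hu, hv⟩ := ih h
      exact ⟨a :: u, v, rfl, .terminal a hu, hv⟩
    | nonterminal ht h =>
      obtain ⟨u, v, rfl, hu, hv⟩ := ih h
      exact ⟨_, v, (List.append_assoc _ _ _).symm, .nonterminal ht hu, hv⟩

lemma Expands.cons_symbol {A : N ⊕ T} {x : List (N ⊕ (T ⊕ Fin n))} {w : List (T ⊕ Fin n)}
    (h : Expands e G (Sum.map id Sum.inl A :: x) w) :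
    ∃ t u, w = t.yield ++ u ∧ IsParseTree e G A t ∧ Expands e G x u := by
  cases A with
  | inl X =>
    cases h with
    | nonterminal ht h => exact ⟨_, _, rfl, ht, h⟩
  | inr a =>
    cases h with
    | terminal _ h => exact ⟨.leaf a, _, rfl, .leaf a, h⟩

lemma Expands.of_rhs (hG : G.Admissible) {X : N} {w : List (T ⊕ Fin n)}
    (h : Expands e G ((G.primed e).rhs X) w) : Expands e G [Sum.inl X] w := by
  obtain ⟨A, B, hX⟩ := List.length_eq_two.1 (hG.1 X)
  simp only [SLG.primed, hX] at h
  obtain ⟨l, u, rfl, hl, h₁⟩ := h.cons_symbol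
  cases h₁ with
  | terminal _ h₂ =>
    obtain ⟨r, u, rfl, hr, h₃⟩ := h₂.cons_symbol
    cases h₃
    have := Expands.nonterminal (.node hX hl hr) (.nil : Expands e G [] [])
    simpa [yield] using this

lemma expands_of_derives (hG : G.Admissible) {x : List (N ⊕ (T ⊕ Fin n))}
    {u : List (T ⊕ Fin n)} (h : (G.primed e).Derives x (u.map Sum.inr)) :
    Expands e G x u := by
  induction h using Relation.ReflTransGen.head_induction_on with
  | refl => exact expands_map_inr u
  | head hstep _ ih =>
    obtain ⟨p, q, X, rfl, rfl⟩ := hstep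
    rw [List.append_assoc] at ih
    obtain ⟨u₁, v, rfl, h₁, h⟩ := ih.split
    obtain ⟨u₂, u₃, rfl, h₂, h₃⟩ := h.split
    exact h₁.append ((h₂.of_rhs hG).append h₃)

lemma exists_isParseTree (hG : G.Admissible) {X : N} {u : List (T ⊕ Fin n)}
    (h : (G.primed e).IsExp X u) :
    ∃ t, IsParseTree e G (Sum.inl X) t ∧ t.yield = u := by
  have h' := expands_of_derives hG h
  clear h
  cases h' with
  | nonterminal ht h =>
    cases h
    exact ⟨_, ht, by simp⟩

lemma isPartial_initSLG {L R : Fin n → ParseTree T n} {t : N → ParseTree T n}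
    {expD : N → List (T ⊕ Fin n)} (ht : ∀ X, (t X).yield = expD X) :
    IsPartial (fun i => t (e i)) L R (initSLG (alphaWord e expD)) (fun _ => none) where
  rhs_start := by
    simp [initSLG, alphaWord, startText, word_none, ht, List.map_flatMap]
  ne_start := by simp
  rhs_some := by simp
  inj := by simp
  surj p := .inl (Subsingleton.elim _ _)

lemma IsPartial.isomorphic {P : Type} {τ L R : Fin n → ParseTree T n}
    {A B : Fin n → N ⊕ T} {H : SLG (T ⊕ Fin n ⊕ Fin (2 * n)) P} {μ : Fin n → Option P}
    (hnode : ∀ i, τ i = node i (L i) (R i)) (hrhs : ∀ i, G.rhs (e i) = [A i, B i])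
    (hL : ∀ i, IsParseTree e G (A i) (L i)) (hR : ∀ i, IsParseTree e G (B i) (R i))
    (h : IsPartial τ L R H μ) (hμ : ∀ i, μ i ≠ none) :
    H.Isomorphic (GI G e Finset.univ) := by
  choose m hm using fun i => Option.ne_none_iff_exists'.1 (hμ i)
  let φ : Option {i : Fin n // i ∈ Finset.univ} → P := fun
    | none => H.start
    | some i => m i.1
  have hφ : Function.Bijective φ := by
    constructor
    · rintro (_ | ⟨i, hi⟩) (_ | ⟨j, hj⟩) hij
      · rfl
      · exact absurd hij.symm (h.ne_start j _ (hm j))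
      · exact absurd hij (h.ne_start i _ (hm i))
      · have hij' : m i = m j := hij
        obtain rfl := h.inj i j (m i) (hm i) (by rw [hm j, hij'])
        rfl
    · intro p
      rcases h.surj p with rfl | ⟨i, hi⟩
      · exact ⟨none, rfl⟩
      · exact ⟨some ⟨i, Finset.mem_univ i⟩, Option.some.inj ((hm i).symm.trans hi)⟩
  let g := (Equiv.ofBijective φ hφ).symm
  have hg : ∀ Y, g (φ Y) = Y := (Equiv.ofBijective φ hφ).symm_apply_apply
  have hgm : ∀ i, g (m i) = some ⟨i, Finset.mem_univ i⟩ := fun i => hg (some ⟨i, _⟩)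
  have hbexp : ∀ i : Fin n, ∀ x t, IsParseTree e G x t →
      bexp G e Finset.univ x = (t.word μ).map (Sum.map g id) := by
    intro i x t ht
    obtain ⟨k, rfl⟩ : ∃ k, n = k + 1 := ⟨n - 1, by have := i.isLt; omega⟩
    cases ht with
    | leaf t => simp [bexp, bexpFuel, word]
    | node _ _ _ => simp [bexp, bexpFuel, word_node_some (hm _), hgm]
  have hτ : ∀ i, IsParseTree e G (Sum.inl (e i)) (τ i) := fun i => by
    rw [hnode i]
    simpa using IsParseTree.node (e := e) (hrhs i) (hL i) (hR i)
  refine ⟨g, hg none, fun X => ?_⟩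
  obtain ⟨Y, rfl⟩ := hφ.2 X
  rw [hg]
  rcases Y with _ | ⟨i, hi⟩
  · change _ = (H.rhs H.start).map _
    rw [h.rhs_start]
    simp [GI, startText, List.map_flatMap, fun i => hbexp i _ _ (hτ i)]
  · change _ = (H.rhs (m i)).map _
    rw [h.rhs_some i _ (hm i)]
    simp [GI, hrhs, hbexp i _ _ (hL i), hbexp i _ _ (hR i)]

end Grammar

end GlobalGrammar

/-- The output of every global algorithm on the string `w ∈ α(G)` is
isomorphic to the grammar `G_{{1,…,|V|}}`: every run of a global algorithm on `w` that
terminates (i.e. its final grammar admits no maximal string) ends with a grammar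
isomorphic to `G_{Finset.univ}`. -/
theorem global_output_grammar {T N : Type} [DecidableEq T] [Fintype N] {n : ℕ}
    (e : Fin n ≃ N) (G : SLG T N) (hG : G.Admissible)
    (expn : N → List T) (hexpn : ∀ X, G.IsExp X (expn X))
    (hord : ∀ i j : Fin n, i ≤ j → (expn (e i)).length ≤ (expn (e j)).length)
    (expD : N → List (T ⊕ Fin n)) (hexpD : ∀ X, (G.primed e).IsExp X (expD X))
    (K : ℕ) (Gs : (k : ℕ) → SLG (T ⊕ Fin n ⊕ Fin (2 * n)) (Fin (k + 1)))
    (hrun : IsGlobalRun (alphaWord e expD) K Gs)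
    (hterm : ∀ s, ¬ (Gs K).IsMaximal s) :
    (Gs K).Isomorphic (GI G e Finset.univ) := by
  choose t ht hyield using fun X => GlobalGrammar.exists_isParseTree hG (hexpD X)
  have hnode : ∀ i, ∃ (L R : GlobalGrammar.ParseTree T n) (A B : N ⊕ T),
      t (e i) = .node i L R ∧ G.rhs (e i) = [A, B] ∧
      GlobalGrammar.IsParseTree e G A L ∧ GlobalGrammar.IsParseTree e G B R := by
    intro i
    have hi := ht (e i)
    generalize t (e i) = t' at hi
    cases hi with
    | node hX hA hB => exact ⟨_, _, _, _, by simp, hX, hA, hB⟩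
  choose L R A B hLR hrhs hL hR using hnode
  have hcoh : ∀ i, (t (e i)).Coherent (fun i => t (e i)) := fun i => (ht (e i)).coherent ht
  have hinv : ∀ k ≤ K, ∃ μ,
      GlobalGrammar.IsPartial (fun i => t (e i)) L R (Gs k) μ := by
    intro k
    induction k with
    | zero =>
      intro _
      rw [hrun.1]
      exact ⟨_, GlobalGrammar.isPartial_initSLG hyield⟩
    | succ k ih =>
      intro hk
      obtain ⟨μ, hμ⟩ := ih (by omega)
      obtain ⟨s, hs, hstep⟩ := hrun.2 k (by omega)
      obtain ⟨i, hi, rfl⟩ := hμ.eq_word_of_isMaximal hLR hcoh hs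
      rw [hstep]
      exact ⟨_, (hμ.globalStep hLR hcoh hi).relabel _⟩
  obtain ⟨μ, hμ⟩ := hinv K le_rfl
  refine hμ.isomorphic hLR hrhs hL hR fun i hi => ?_
  obtain ⟨s, hs⟩ := hμ.exists_isMaximal hLR hcoh hi
  exact hterm s hs
end

section
/- Every global algorithm with the string w as input outputs a grammar of size exactly (7/2)·|G| = 7·|V|. -/
instance Sum.instLawfulBEq {A B : Type*} [BEq A] [BEq B] [LawfulBEq A] [LawfulBEq B] :
    LawfulBEq (A ⊕ B) where
  eq_of_beq {a b} h := by
    cases a <;> cases b <;> first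
      | exact congrArg _ (eq_of_beq h)
      | exact absurd h Bool.false_ne_true
  rfl {a} := by
    cases a with
    | inl a => exact BEq.rfl (a := a)
    | inr b => exact BEq.rfl (a := b)

section GreedyLemmas

variable {A B : Type}

theorem List.prefix_append_cons_iff_of_notMem {p l₁ l₂ : List A} {x : A} (hx : x ∉ p) :
    p <+: l₁ ++ x :: l₂ ↔ p <+: l₁ := by
  refine ⟨fun h => ?_, fun h => h.trans (List.prefix_append _ _)⟩
  induction l₁ generalizing p with
  | nil =>
    cases p with
    | nil => simp
    | cons b p => simp_all [List.cons_prefix_cons]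
  | cons a l₁ ih =>
    cases p with
    | nil => simp
    | cons b p =>
      simp only [List.cons_append, List.cons_prefix_cons, List.mem_cons, not_or] at *
      exact ⟨h.1, ih hx.2 h.2⟩

theorem List.infix_append_cons_of_notMem {p l₁ l₂ : List A} {x : A} (hx : x ∉ p)
    (h : p <:+: l₁ ++ x :: l₂) : p <:+: l₁ ∨ p <:+: l₂ := by
  induction l₁ with
  | nil =>
    rcases List.infix_cons_iff.1 h with h | h
    · exact Or.inl ((List.prefix_append_cons_iff_of_notMem (l₁ := []) hx).1 h).isInfix
    · exact Or.inr h
  | cons a l₁ ih =>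
    rcases List.infix_cons_iff.1 h with h | h
    · exact Or.inl ((List.prefix_append_cons_iff_of_notMem (l₁ := a :: l₁) hx).1 h).isInfix
    · exact (ih h).imp_left fun h => h.trans (List.suffix_cons _ _).isInfix

theorem List.IsPrefix.cons_eq_append_drop {p t : List A} {a : A} (hp : p ≠ [])
    (h : p <+: a :: t) : a :: t = p ++ t.drop (p.length - 1) := by
  obtain ⟨q, hq⟩ := h
  cases p with
  | nil => exact absurd rfl hp
  | cons b p =>
    obtain ⟨rfl, rfl⟩ := List.cons.inj hq
    simp

variable [DecidableEq A]

theorem greedyReplace_of_notMem {p l : List A} {c : B} {f : A → B} {y : A} (hy : y ∈ p)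
    (hl : y ∉ l) : greedyReplace p c f l = l.map f := by
  induction l with
  | nil => simp [greedyReplace]
  | cons a t ih =>
    have : ¬ (p ≠ [] ∧ p <+: a :: t) := fun h => hl (h.2.subset hy)
    rw [greedyReplace, if_neg this, ih fun h => hl (List.mem_cons_of_mem _ h), List.map_cons]

theorem greedyReplace_self {p : List A} (hp : p ≠ []) (c : B) (f : A → B) :
    greedyReplace p c f p = [c] := by
  cases p with
  | nil => exact absurd rfl hp
  | cons a t => simp [greedyReplace]

theorem greedyCount_self {p : List A} (hp : p ≠ []) : greedyCount p p = 1 := by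
  cases p with
  | nil => exact absurd rfl hp
  | cons a t => simp [greedyCount]

theorem greedyReplace_singleton {p : List A} (hp : 2 ≤ p.length) (c : B) (f : A → B) (a : A) :
    greedyReplace p c f [a] = [f a] := by
  have : ¬ (p ≠ [] ∧ p <+: [a]) := fun h => by
    have := h.2.length_le
    simp only [List.length_singleton] at this
    omega
  rw [greedyReplace, if_neg this, greedyReplace]

theorem greedyReplace_append_cons {p : List A} (c : B) (f : A → B) {x : A} (hx : x ∉ p)
    (l₁ l₂ : List A) : greedyReplace p c f (l₁ ++ x :: l₂) =
      greedyReplace p c f l₁ ++ f x :: greedyReplace p c f l₂ := by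
  induction l₁ using greedyCount.induct p with
  | case1 =>
    have : ¬ (p ≠ [] ∧ p <+: x :: l₂) := fun h =>
      h.1 (List.prefix_nil.1 ((List.prefix_append_cons_iff_of_notMem (l₁ := []) hx).1 h.2))
    rw [List.nil_append, greedyReplace.eq_2, if_neg this, greedyReplace, List.nil_append]
  | case2 a t h ih =>
    have h' := (List.prefix_append_cons_iff_of_notMem (l₁ := a :: t) (l₂ := l₂) hx).2 h.2
    have hlen := h.2.length_le
    rw [List.length_cons] at hlen
    rw [List.cons_append] at h' ⊢
    rw [greedyReplace, if_pos ⟨h.1, h'⟩, greedyReplace, if_pos h,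
      List.drop_append_of_le_length (by omega), ih, List.cons_append]
  | case3 a t h ih =>
    have h' := mt (fun h => And.imp_right
      (List.prefix_append_cons_iff_of_notMem (l₁ := a :: t) (l₂ := l₂) hx).1 h) h
    rw [List.cons_append] at h' ⊢
    rw [greedyReplace, if_neg h', greedyReplace, if_neg h, ih, List.cons_append]

theorem greedyCount_eq_count_greedyReplace (p l : List A) :
    greedyCount p l = (greedyReplace p true (fun _ => false) l).count true := by
  induction l using greedyCount.induct p with
  | case1 => simp [greedyCount, greedyReplace]
  | case2 a t h ih =>
    rw [greedyCount, if_pos h, greedyReplace, if_pos h, ih, List.count_cons_self, add_comm]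
  | case3 a t h ih =>
    rw [greedyCount, if_neg h, greedyReplace, if_neg h, ih]
    simp

theorem greedyCount_append_cons {p : List A} {x : A} (hx : x ∉ p) (l₁ l₂ : List A) :
    greedyCount p (l₁ ++ x :: l₂) = greedyCount p l₁ + greedyCount p l₂ := by
  simp [greedyCount_eq_count_greedyReplace, greedyReplace_append_cons _ _ hx]

theorem greedyCount_le_count [BEq A] [LawfulBEq A] {p : List A} {x : A} (hx : x ∈ p) (l : List A) :
    greedyCount p l ≤ l.count x := by
  induction l using greedyCount.induct p with
  | case1 => simp [greedyCount]
  | case2 a t h ih =>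
    have := List.count_pos_iff.2 hx
    rw [greedyCount, if_pos h, h.2.cons_eq_append_drop h.1, List.count_append]
    omega
  | case3 a t h ih =>
    rw [greedyCount, if_neg h, List.count_cons]
    omega

theorem infix_of_greedyCount_pos {p l : List A} (h : 0 < greedyCount p l) : p <:+: l := by
  induction l using greedyCount.induct p with
  | case1 => simp [greedyCount] at h
  | case2 a t h' => exact h'.2.isInfix
  | case3 a t h' ih =>
    rw [greedyCount, if_neg h'] at h
    exact (ih h).trans (List.suffix_cons _ _).isInfix

end GreedyLemmas

namespace SLG

section Expansion

variable {T N : Type}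

/-- Leftmost evaluation of a sentential form: `G.Evaluates x u` means that `x` expands to the
terminal string `u`. -/
inductive Evaluates (G : SLG T N) : List (N ⊕ T) → List T → Prop
  | nil : Evaluates G [] []
  | terminal (t : T) {x u} : Evaluates G x u → Evaluates G (Sum.inr t :: x) (t :: u)
  | nonterminal (X : N) {x u} : Evaluates G (G.rhs X ++ x) u → Evaluates G (Sum.inl X :: x) u

variable {G : SLG T N}

theorem Evaluates.unique {x : List (N ⊕ T)} {u v : List T} (hu : G.Evaluates x u)
    (hv : G.Evaluates x v) : u = v := by
  induction hu generalizing v with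
  | nil => cases hv; rfl
  | terminal t _ ih => cases hv with | terminal _ h => rw [ih h]
  | nonterminal X _ ih => cases hv with | nonterminal _ h => exact ih h

theorem Evaluates.append_inv {x y : List (N ⊕ T)} {u : List T} (h : G.Evaluates (x ++ y) u) :
    ∃ v w, G.Evaluates x v ∧ G.Evaluates y w ∧ u = v ++ w := by
  generalize hz : x ++ y = z at h
  induction h generalizing x with
  | nil =>
    obtain ⟨rfl, rfl⟩ := List.append_eq_nil_iff.1 hz
    exact ⟨[], [], .nil, .nil, rfl⟩
  | @terminal t z u h ih =>
    cases x with
    | nil => exact ⟨[], t :: u, .nil, by rw [List.nil_append] at hz; exact hz ▸ .terminal t h, rfl⟩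
    | cons a x =>
      rw [List.cons_append] at hz
      obtain ⟨rfl, hz'⟩ := List.cons.inj hz
      obtain ⟨v, w, hv, hw, rfl⟩ := ih hz'
      exact ⟨t :: v, w, .terminal t hv, hw, rfl⟩
  | @nonterminal X z u h ih =>
    cases x with
    | nil => exact ⟨[], u, .nil, by rw [List.nil_append] at hz; exact hz ▸ .nonterminal X h, rfl⟩
    | cons a x =>
      rw [List.cons_append] at hz
      obtain ⟨rfl, hz'⟩ := List.cons.inj hz
      obtain ⟨v, w, hv, hw, rfl⟩ := ih (x := G.rhs X ++ x) (by rw [List.append_assoc, hz'])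
      exact ⟨v, w, .nonterminal X hv, hw, rfl⟩

theorem Evaluates.of_produces {x y : List (N ⊕ T)} {u : List T} (hxy : G.Produces x y)
    (h : G.Evaluates y u) : G.Evaluates x u := by
  obtain ⟨p, q, X, rfl, rfl⟩ := hxy
  generalize hz : p ++ G.rhs X ++ q = z at h
  induction h generalizing p with
  | nil =>
    simp only [List.append_eq_nil_iff] at hz
    obtain ⟨⟨rfl, hX⟩, rfl⟩ := hz
    exact .nonterminal X (by rw [hX]; exact .nil)
  | @terminal t z u h ih =>
    cases p with
    | nil => exact .nonterminal X (by rw [List.nil_append] at hz; exact hz ▸ .terminal t h)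
    | cons a p =>
      rw [List.cons_append, List.cons_append] at hz
      obtain ⟨rfl, hz'⟩ := List.cons.inj hz
      exact .terminal t (ih p hz')
  | @nonterminal Y z u h ih =>
    cases p with
    | nil => exact .nonterminal X (by rw [List.nil_append] at hz; exact hz ▸ .nonterminal Y h)
    | cons a p =>
      rw [List.cons_append, List.cons_append] at hz
      obtain ⟨rfl, hz'⟩ := List.cons.inj hz
      have := ih (G.rhs Y ++ p) (by rw [← hz']; simp)
      exact .nonterminal Y (by simpa using this)

theorem evaluates_map_inr (G : SLG T N) (u : List T) : G.Evaluates (u.map Sum.inr) u := by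
  induction u with
  | nil => exact .nil
  | cons t u ih => exact .terminal t ih

theorem IsExp.evaluates {X : N} {u : List T} (h : G.IsExp X u) : G.Evaluates [Sum.inl X] u := by
  change Relation.ReflTransGen G.Produces _ _ at h
  generalize [Sum.inl X] = x at h
  induction h using Relation.ReflTransGen.head_induction_on with
  | refl => exact G.evaluates_map_inr u
  | head hxy _ ih => exact ih.of_produces hxy

/-- Extend a family of words indexed by nonterminals to all symbols, a terminal `t` being
assigned the one-letter word `[τ t]`. -/
def symWord {S : Type} (E : N → List S) (τ : T → S) : N ⊕ T → List S :=
  Sum.elim E fun t => [τ t]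

theorem Evaluates.eq_symWord {E : N → List T} (hE : ∀ X, G.IsExp X (E X)) {a : N ⊕ T}
    {u : List T} (h : G.Evaluates [a] u) : u = symWord E id a := by
  cases a with
  | inl X => exact h.unique (hE X).evaluates
  | inr t => exact h.unique (.terminal t .nil)

theorem IsExp.primed_eq {n : ℕ} {e : Fin n ≃ N} {E : N → List (T ⊕ Fin n)}
    (hE : ∀ X, (G.primed e).IsExp X (E X)) {X : N} {a b : N ⊕ T} (hX : G.rhs X = [a, b]) :
    E X = symWord E Sum.inl a ++ Sum.inr (e.symm X) :: symWord E Sum.inl b := by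
  have h : (G.primed e).Evaluates [Sum.map id Sum.inl a, Sum.inr (Sum.inr (e.symm X)),
      Sum.map id Sum.inl b] (E X) := by
    cases (hE X).evaluates with
    | nonterminal _ h => simpa [primed, hX] using h
  obtain ⟨u, v, hu, hv, huv⟩ := Evaluates.append_inv (x := [_]) h
  cases hv with
  | terminal _ hv =>
    have key : ∀ c : N ⊕ T, symWord E id (Sum.map id Sum.inl c) = symWord E Sum.inl c := by
      rintro (c | c) <;> rfl
    rw [huv, hu.eq_symWord hE, hv.eq_symWord hE, key, key]

end Expansion

section Snapshot

variable {T N M : Type} {n : ℕ}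

/-- The separator `$_X` inside the right-hand side of the nonterminal `X`. -/
def dollar (e : Fin n ≃ N) (X : N) : M ⊕ (T ⊕ Fin n ⊕ Fin (2 * n)) :=
  Sum.inr (Sum.inr (Sum.inl (e.symm X)))

/-- The separator `#_j` of the input word. -/
def hash (j : Fin (2 * n)) : M ⊕ (T ⊕ Fin n ⊕ Fin (2 * n)) :=
  Sum.inr (Sum.inr (Sum.inr j))

/-- A symbol of the original grammar, as a word over the symbols of the current grammar. -/
def letterWord (E : N → List (M ⊕ (T ⊕ Fin n ⊕ Fin (2 * n)))) :
    N ⊕ T → List (M ⊕ (T ⊕ Fin n ⊕ Fin (2 * n))) :=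
  symWord E fun t => Sum.inr (Sum.inl t)

/-- The word `A $_X B` for a rule `X → A B`, with `A` and `B` written out by `E`. -/
def ruleWord (e : Fin n ≃ N) (c : N → (N ⊕ T) × (N ⊕ T))
    (E : N → List (M ⊕ (T ⊕ Fin n ⊕ Fin (2 * n)))) (X : N) :
    List (M ⊕ (T ⊕ Fin n ⊕ Fin (2 * n))) :=
  letterWord E (c X).1 ++ dollar e X :: letterWord E (c X).2

/-- The part of the start rule belonging to the nonterminals with index in `L`. -/
def startWord (e : Fin n ≃ N) (E : N → List (M ⊕ (T ⊕ Fin n ⊕ Fin (2 * n)))) (L : List (Fin n)) :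
    List (M ⊕ (T ⊕ Fin n ⊕ Fin (2 * n))) :=
  L.flatMap fun i =>
    E (e i) ++ hash ⟨2 * i.val, by have := i.isLt; omega⟩ ::
      (E (e i) ++ [hash ⟨2 * i.val + 1, by have := i.isLt; omega⟩])

/-- The measure `r` decreases from every nonterminal to the nonterminals in its rule. -/
def Descends (c : N → (N ⊕ T) × (N ⊕ T)) (r : N → ℕ) : Prop :=
  ∀ X Y, (c X).1 = Sum.inl Y ∨ (c X).2 = Sum.inl Y → r Y < r X

/-- The shape of an intermediate grammar of a global algorithm: `ν X = some m` says that `X` has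
already been given the nonterminal `m`, and `E X` is the current form of the expansion of `X`. -/
structure Snapshot [Fintype M] [Fintype N] (e : Fin n ≃ N) (c : N → (N ⊕ T) × (N ⊕ T))
    (H : SLG (T ⊕ Fin n ⊕ Fin (2 * n)) M) (ν : N → Option M)
    (E : N → List (M ⊕ (T ⊕ Fin n ⊕ Fin (2 * n)))) : Prop where
  named : ∀ {X m}, ν X = some m → E X = [Sum.inl m]
  unnamed : ∀ {X}, ν X = none → E X = ruleWord e c E X
  rhs_start : H.rhs H.start = startWord e E (List.finRange n)
  rhs_named : ∀ {X m}, ν X = some m → H.rhs m = ruleWord e c E X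
  sum_eq : ∀ F : M → ℕ, ∑ m, F m = F H.start + ∑ X, (ν X).elim 0 F

theorem startWord_cons (e : Fin n ≃ N) (E : N → List (M ⊕ (T ⊕ Fin n ⊕ Fin (2 * n))))
    (i : Fin n) (L : List (Fin n)) : startWord e E (i :: L) =
      E (e i) ++ hash ⟨2 * i.val, by have := i.isLt; omega⟩ ::
        (E (e i) ++ hash ⟨2 * i.val + 1, by have := i.isLt; omega⟩ :: startWord e E L) := by
  simp [startWord]

theorem dollar_inj {e : Fin n ≃ N} {X Y : N} :
    (dollar e X : M ⊕ (T ⊕ Fin n ⊕ Fin (2 * n))) = dollar e Y ↔ X = Y := by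
  simp [dollar]

theorem hash_inj {i j : Fin (2 * n)} :
    (hash i : M ⊕ (T ⊕ Fin n ⊕ Fin (2 * n))) = hash j ↔ i = j := by
  simp [hash]

theorem dollar_ne_hash {e : Fin n ≃ N} {X : N} {j : Fin (2 * n)} :
    (dollar e X : M ⊕ (T ⊕ Fin n ⊕ Fin (2 * n))) ≠ hash j := by
  simp [dollar, hash]

/-- Induction along the parse forest, for a property of symbols. -/
theorem Descends.induction {c : N → (N ⊕ T) × (N ⊕ T)} {r : N → ℕ}
    (hr : Descends c r) {P : N ⊕ T → Prop}
    (terminal : ∀ t, P (Sum.inr t))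
    (step : ∀ X, P (c X).1 → P (c X).2 → P (Sum.inl X)) (a : N ⊕ T) : P a := by
  have main : ∀ k X, r X < k → P (Sum.inl X) := by
    intro k
    induction k with
    | zero => intro X h; omega
    | succ k ih =>
      intro X hX
      refine step X ?_ ?_
      · rcases hc : (c X).1 with Y | t
        · exact ih Y (by have := hr X Y (Or.inl hc); omega)
        · exact terminal t
      · rcases hc : (c X).2 with Y | t
        · exact ih Y (by have := hr X Y (Or.inr hc); omega)
        · exact terminal t
  cases a with
  | inl X => exact main _ X (Nat.lt_succ_self _)
  | inr t => exact terminal t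

namespace Snapshot

variable [Fintype M] [Fintype N] {e : Fin n ≃ N} {c : N → (N ⊕ T) × (N ⊕ T)}
  {H : SLG (T ⊕ Fin n ⊕ Fin (2 * n)) M} {ν : N → Option M}
  {E : N → List (M ⊕ (T ⊕ Fin n ⊕ Fin (2 * n)))} {r : N → ℕ}

theorem ne_nil (h : Snapshot e c H ν E) (X : N) : E X ≠ [] := by
  cases hX : ν X with
  | none => simp [h.unnamed hX, ruleWord]
  | some m => simp [h.named hX]

theorem letterWord_ne_nil (h : Snapshot e c H ν E) (a : N ⊕ T) : letterWord E a ≠ [] := by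
  cases a with
  | inl X => exact h.ne_nil X
  | inr t => simp [letterWord, symWord]

theorem two_le_length (h : Snapshot e c H ν E) {X : N} (hX : ν X = none) : 2 ≤ (E X).length := by
  have := List.length_pos_iff.2 (h.letterWord_ne_nil (c X).1)
  rw [h.unnamed hX, ruleWord]
  simp only [List.length_append, List.length_cons]
  omega

theorem dollar_mem (h : Snapshot e c H ν E) {X : N} (hX : ν X = none) : dollar e X ∈ E X := by
  simp [h.unnamed hX, ruleWord]

theorem hash_notMem (h : Snapshot e c H ν E) (hr : Descends c r) (j : Fin (2 * n)) (a : N ⊕ T) :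
    hash j ∉ letterWord E a := by
  induction a using Descends.induction hr with
  | terminal t => simp [letterWord, symWord, hash]
  | step X ih₁ ih₂ =>
    change hash j ∉ E X
    cases hX : ν X with
    | none => simp [h.unnamed hX, ruleWord, ih₁, ih₂, dollar_ne_hash.symm]
    | some m => simp [h.named hX, hash]

theorem unnamed_of_dollar_mem (h : Snapshot e c H ν E) (hr : Descends c r) {Y : N} {a : N ⊕ T}
    (hY : dollar e Y ∈ letterWord E a) : ν Y = none := by
  induction a using Descends.induction hr with
  | terminal t => simp [letterWord, symWord, dollar] at hY
  | step X ih₁ ih₂ =>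
    change dollar e Y ∈ E X at hY
    cases hX : ν X with
    | none =>
      simp only [h.unnamed hX, ruleWord, List.mem_append, List.mem_cons, dollar_inj] at hY
      rcases hY with hY | rfl | hY
      · exact ih₁ hY
      · exact hX
      · exact ih₂ hY
    | some m => simp [h.named hX, dollar] at hY

theorem rank_le_of_dollar_mem (h : Snapshot e c H ν E) (hr : Descends c r) {Y : N} {a : N ⊕ T}
    (hY : dollar e Y ∈ letterWord E a) : ∃ X, a = Sum.inl X ∧ (Y = X ∨ r Y < r X) := by
  induction a using Descends.induction hr with
  | terminal t => simp [letterWord, symWord, dollar] at hY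
  | step X ih₁ ih₂ =>
    refine ⟨X, rfl, ?_⟩
    change dollar e Y ∈ E X at hY
    cases hX : ν X with
    | none =>
      simp only [h.unnamed hX, ruleWord, List.mem_append, List.mem_cons, dollar_inj] at hY
      rcases hY with hY | rfl | hY
      · obtain ⟨Z, hZ, hYZ⟩ := ih₁ hY
        have := hr X Z (Or.inl hZ)
        rcases hYZ with rfl | hYZ
        · exact Or.inr this
        · exact Or.inr (hYZ.trans this)
      · exact Or.inl rfl
      · obtain ⟨Z, hZ, hYZ⟩ := ih₂ hY
        have := hr X Z (Or.inr hZ)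
        rcases hYZ with rfl | hYZ
        · exact Or.inr this
        · exact Or.inr (hYZ.trans this)
    | some m => simp [h.named hX, dollar] at hY

theorem dollar_notMem_children (h : Snapshot e c H ν E) (hr : Descends c r) (X : N) :
    dollar e X ∉ letterWord E (c X).1 ∧ dollar e X ∉ letterWord E (c X).2 := by
  constructor <;> intro hX <;> obtain ⟨Y, hY, hXY⟩ := h.rank_le_of_dollar_mem hr hX
  · have := hr X Y (Or.inl hY)
    rcases hXY with rfl | hXY <;> omega
  · have := hr X Y (Or.inr hY)
    rcases hXY with rfl | hXY <;> omega

theorem dollar_notMem_or (h : Snapshot e c H ν E) (hr : Descends c r) {X Z : N} (hXZ : X ≠ Z) :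
    dollar e X ∉ E Z ∨ dollar e Z ∉ E X := by
  by_contra! hc
  obtain ⟨_, hZ, h₁⟩ := h.rank_le_of_dollar_mem hr (a := Sum.inl Z) hc.1
  obtain ⟨_, hX, h₂⟩ := h.rank_le_of_dollar_mem hr (a := Sum.inl X) hc.2
  cases hZ
  cases hX
  rcases h₁ with h₁ | h₁
  · exact hXZ h₁
  · rcases h₂ with h₂ | h₂
    · exact hXZ h₂.symm
    · omega

theorem dollar_notMem_startWord (h : Snapshot e c H ν E) (hr : Descends c r) {X : N} (hX : ν X ≠ none)
    (L : List (Fin n)) : dollar e X ∉ startWord e E L := by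
  induction L with
  | nil => simp [startWord]
  | cons i L ih =>
    have : dollar e X ∉ E (e i) := fun hm => hX (h.unnamed_of_dollar_mem hr (a := Sum.inl (e i)) hm)
    simp [startWord_cons, ih, this, dollar_ne_hash]

theorem infix_of_infix_letterWord (h : Snapshot e c H ν E) (hr : Descends c r)
    {p : List (M ⊕ (T ⊕ Fin n ⊕ Fin (2 * n)))} (hp : 2 ≤ p.length) {a : N ⊕ T}
    (ha : p <:+: letterWord E a) : ∃ Z, ν Z = none ∧ dollar e Z ∈ p ∧ p <:+: E Z := by
  induction a using Descends.induction hr with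
  | terminal t =>
    have := ha.length_le
    simp only [letterWord, symWord, Sum.elim_inr, List.length_singleton] at this
    omega
  | step X ih₁ ih₂ =>
    change p <:+: E X at ha
    cases hX : ν X with
    | none =>
      by_cases hXp : dollar e X ∈ p
      · exact ⟨X, hX, hXp, ha⟩
      rw [h.unnamed hX] at ha
      exact (List.infix_append_cons_of_notMem hXp ha).elim ih₁ ih₂
    | some m =>
      have := ha.length_le
      simp only [h.named hX, List.length_singleton] at this
      omega

theorem infix_of_infix_startWord (h : Snapshot e c H ν E) (hr : Descends c r)
    {p : List (M ⊕ (T ⊕ Fin n ⊕ Fin (2 * n)))} (hp : 2 ≤ p.length) (hh : ∀ j, hash j ∉ p)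
    {L : List (Fin n)} (hL : p <:+: startWord e E L) :
    ∃ Z, ν Z = none ∧ dollar e Z ∈ p ∧ p <:+: E Z := by
  induction L with
  | nil =>
    have := hL.length_le
    simp only [startWord, List.flatMap_nil, List.length_nil] at this
    omega
  | cons i L ih =>
    rw [startWord_cons] at hL
    rcases List.infix_append_cons_of_notMem (hh _) hL with hL | hL
    · exact h.infix_of_infix_letterWord hr hp (a := Sum.inl (e i)) hL
    rcases List.infix_append_cons_of_notMem (hh _) hL with hL | hL
    · exact h.infix_of_infix_letterWord hr hp (a := Sum.inl (e i)) hL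
    · exact ih hL

theorem relabel {M' : Type} [Fintype M'] (h : Snapshot e c H ν E) (g : M ≃ M') :
    Snapshot e c (H.relabel g) (fun X => (ν X).map g) (fun X => (E X).map (Sum.map g id)) := by
  have hletter : ∀ a, letterWord (fun X => (E X).map (Sum.map g id)) a =
      (letterWord E a).map (Sum.map g id) := by
    rintro (X | t) <;> rfl
  have hrule : ∀ X, ruleWord e c (fun X => (E X).map (Sum.map g id)) X =
      (ruleWord e c E X).map (Sum.map g id) := fun X => by
    simp [ruleWord, hletter, dollar]
  refine ⟨fun {X m} hX => ?_, fun {X} hX => ?_, ?_, fun {X m} hX => ?_, fun F => ?_⟩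
  · obtain ⟨m, hm, rfl⟩ := Option.map_eq_some_iff.1 hX
    simp [h.named hm]
  · rw [hrule, ← h.unnamed (Option.map_eq_none_iff.1 hX)]
  · simp [SLG.relabel, h.rhs_start, startWord, List.map_flatMap, hash]
  · obtain ⟨m, hm, rfl⟩ := Option.map_eq_some_iff.1 hX
    simp [SLG.relabel, h.rhs_named hm, hrule]
  · rw [← g.sum_comp, h.sum_eq]
    congr 1
    refine Finset.sum_congr rfl fun X _ => ?_
    cases ν X <;> rfl

theorem size_eq (h : Snapshot e c H ν E) (hν : ∀ X, ν X ≠ none) : H.size = 7 * n := by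
  have hE : ∀ X, (E X).length = 1 := fun X => by
    obtain ⟨m, hm⟩ := Option.ne_none_iff_exists'.1 (hν X)
    simp [h.named hm]
  have hletter : ∀ a, (letterWord E a).length = 1 := by
    rintro (X | t)
    · exact hE X
    · rfl
  have hstart : ∀ L, (startWord e E L).length = 4 * L.length := fun L => by
    induction L with
    | nil => rfl
    | cons i L ih =>
      simp only [startWord_cons, List.length_append, List.length_cons, hE, ih]
      omega
  have hrule : ∀ X, (ν X).elim 0 (fun m => (H.rhs m).length) = 3 := fun X => by
    obtain ⟨m, hm⟩ := Option.ne_none_iff_exists'.1 (hν X)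
    simp [hm, h.rhs_named hm, ruleWord, hletter]
  have hcard : Fintype.card N = n := by simpa using (Fintype.card_congr e).symm
  rw [size, h.sum_eq, h.rhs_start, hstart, Finset.sum_congr rfl fun X _ => hrule X]
  simp [hcard]
  omega

theorem initSLG {c : N → (N ⊕ T) × (N ⊕ T)} {D : N → List (T ⊕ Fin n)}
    (hD : ∀ X, D X =
      symWord D Sum.inl (c X).1 ++ Sum.inr (e.symm X) :: symWord D Sum.inl (c X).2) :
    Snapshot e c (initSLG (alphaWord e D)) (fun _ => none)
      (fun X => (D X).map fun x => Sum.inr (Sum.map id Sum.inl x)) := by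
  refine ⟨nofun, fun {X} _ => ?_, ?_, nofun, fun F => by simp [_root_.initSLG]⟩
  · have hletter : ∀ a, letterWord (M := Fin 1)
        (fun X => (D X).map fun x => Sum.inr (Sum.map id Sum.inl x)) a =
        (symWord D Sum.inl a).map fun x => Sum.inr (Sum.map id Sum.inl x) := by
      rintro (X | t) <;> rfl
    rw [ruleWord, hletter, hletter]
    conv_lhs => rw [hD X, List.map_append, List.map_cons]
    rfl
  · simp [_root_.initSLG, alphaWord, startWord, List.map_flatMap, hash, Function.comp_def]

variable [DecidableEq M] [DecidableEq T]

theorem greedyReplace_ruleWord (h : Snapshot e c H ν E) (hr : Descends c r) {B : Type} (b : B)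
    (f : M ⊕ (T ⊕ Fin n ⊕ Fin (2 * n)) → B) {Z X : N} (hZ : ν Z = none) (hX : X ≠ Z ∨ ν X ≠ none) :
    greedyReplace (E Z) b f (ruleWord e c E X) =
      greedyReplace (E Z) b f (letterWord E (c X).1) ++
        f (dollar e X) :: greedyReplace (E Z) b f (letterWord E (c X).2) := by
  by_cases hmem : dollar e X ∈ E Z
  · have hνX := h.unnamed_of_dollar_mem hr (a := Sum.inl Z) hmem
    have hZX := (h.dollar_notMem_or hr (hX.resolve_right (not_not.2 hνX))).resolve_left
      (not_not.2 hmem)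
    rw [h.unnamed hνX] at hZX
    have hZX' := hZX
    simp only [ruleWord, List.mem_append, List.mem_cons, not_or] at hZX'
    rw [greedyReplace_of_notMem (h.dollar_mem hZ) hZX,
      greedyReplace_of_notMem (h.dollar_mem hZ) hZX'.1,
      greedyReplace_of_notMem (h.dollar_mem hZ) hZX'.2.2]
    simp [ruleWord]
  · exact greedyReplace_append_cons b f hmem _ _

theorem count_dollar_ruleWord_self (h : Snapshot e c H ν E) (hr : Descends c r) (X : N) :
    (ruleWord e c E X).count (dollar e X) = 1 := by
  have := h.dollar_notMem_children hr X
  simp [ruleWord, List.count_eq_zero.2 this.1, List.count_eq_zero.2 this.2]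

theorem greedyCount_ruleWord (h : Snapshot e c H ν E) (hr : Descends c r) {Z X : N} (hZ : ν Z = none)
    (hX : X ≠ Z ∨ ν X ≠ none) :
    greedyCount (E Z) (ruleWord e c E X) =
      greedyCount (E Z) (letterWord E (c X).1) + greedyCount (E Z) (letterWord E (c X).2) := by
  simp [greedyCount_eq_count_greedyReplace, h.greedyReplace_ruleWord hr _ _ hZ hX]

theorem count_dollar_le_greedyCount (h : Snapshot e c H ν E) (hr : Descends c r) {Z : N} (hZ : ν Z = none)
    (a : N ⊕ T) :
    (letterWord E a).count (dollar e Z) ≤ greedyCount (E Z) (letterWord E a) := by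
  induction a using Descends.induction hr with
  | terminal t => simp [letterWord, symWord, dollar]
  | step X ih₁ ih₂ =>
    change (E X).count (dollar e Z) ≤ greedyCount (E Z) (E X)
    by_cases hXZ : X = Z
    · subst hXZ
      rw [greedyCount_self (h.ne_nil X), h.unnamed hZ, h.count_dollar_ruleWord_self hr]
    cases hX : ν X with
    | none =>
      rw [h.unnamed hX, h.greedyCount_ruleWord hr hZ (Or.inl hXZ), ruleWord, List.count_append,
        List.count_cons_of_ne (fun h => hXZ (dollar_inj.1 h))]
      omega
    | some m => simp [h.named hX, dollar]

theorem count_dollar_startWord_le (h : Snapshot e c H ν E) (hr : Descends c r) {Z : N} (hZ : ν Z = none)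
    (L : List (Fin n)) :
    (startWord e E L).count (dollar e Z) ≤ greedyCount (E Z) (startWord e E L) := by
  induction L with
  | nil => simp [startWord]
  | cons i L ih =>
    have hh : ∀ j, hash j ∉ E Z := fun j => h.hash_notMem hr j (Sum.inl Z)
    have := h.count_dollar_le_greedyCount hr hZ (Sum.inl (e i))
    change (E (e i)).count _ ≤ greedyCount (E Z) (E (e i)) at this
    rw [startWord_cons, greedyCount_append_cons (hh _), greedyCount_append_cons (hh _),
      List.count_append, List.count_cons_of_ne dollar_ne_hash.symm, List.count_append,
      List.count_cons_of_ne dollar_ne_hash.symm]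
    omega

theorem sum_count_dollar_le_rhsOccs (h : Snapshot e c H ν E) (hr : Descends c r) {Z : N} (hZ : ν Z = none) :
    ∑ m, (H.rhs m).count (dollar e Z) ≤ H.rhsOccs (E Z) := by
  rw [rhsOccs, h.sum_eq, h.sum_eq, h.rhs_start]
  refine add_le_add (h.count_dollar_startWord_le hr hZ _) (Finset.sum_le_sum fun X _ => ?_)
  cases hX : ν X with
  | none => simp
  | some m =>
    have hXZ : X ≠ Z := by
      rintro rfl
      simp [hX] at hZ
    have h₁ := h.count_dollar_le_greedyCount hr hZ (c X).1
    have h₂ := h.count_dollar_le_greedyCount hr hZ (c X).2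
    rw [Option.elim_some, Option.elim_some, h.rhs_named hX,
      h.greedyCount_ruleWord hr hZ (Or.inl hXZ), ruleWord, List.count_append,
      List.count_cons_of_ne (fun h => hXZ (dollar_inj.1 h))]
    omega

theorem two_le_rhsOccs (h : Snapshot e c H ν E) (hr : Descends c r) {Z : N} (hZ : ν Z = none) :
    2 ≤ H.rhsOccs (E Z) := by
  refine le_trans ?_ (h.sum_count_dollar_le_rhsOccs hr hZ)
  rw [h.sum_eq, h.rhs_start]
  obtain ⟨L₁, L₂, hL⟩ := List.append_of_mem (List.mem_finRange (e.symm Z))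
  have hpos := List.count_pos_iff.2 (h.dollar_mem hZ)
  have happ : startWord e E (L₁ ++ e.symm Z :: L₂) =
      startWord e E L₁ ++ startWord e E (e.symm Z :: L₂) := by
    simp [startWord]
  rw [hL, happ, startWord_cons, Equiv.apply_symm_apply]
  simp only [List.count_append, List.count_cons]
  omega

theorem count_hash_startWord (h : Snapshot e c H ν E) (hr : Descends c r) (j : Fin (2 * n)) {L : List (Fin n)}
    (hL : L.Nodup) : (startWord e E L).count (hash j) =
      if ⟨j.val / 2, by have := j.isLt; omega⟩ ∈ L then 1 else 0 := by
  induction L with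
  | nil => simp [startWord]
  | cons i L ih =>
    have hE := List.count_eq_zero.2 (h.hash_notMem hr j (Sum.inl (e i)))
    change (E (e i)).count _ = 0 at hE
    rw [List.nodup_cons] at hL
    rw [startWord_cons]
    simp only [List.count_append, List.count_cons, hE, ih hL.2, beq_iff_eq, hash_inj, Fin.ext_iff,
      List.mem_cons]
    by_cases hi : j.val / 2 = i.val
    · have : (⟨j.val / 2, by have := j.isLt; omega⟩ : Fin n) = i := Fin.ext hi
      rw [this, if_neg hL.1]
      simp only [hi, true_or, if_true]
      split_ifs <;> omega
    · simp only [hi, false_or]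
      split_ifs <;> omega

theorem sum_count_hash_le (h : Snapshot e c H ν E) (hr : Descends c r) (j : Fin (2 * n)) :
    ∑ m, (H.rhs m).count (hash j) ≤ 1 := by
  rw [h.sum_eq, h.rhs_start, h.count_hash_startWord hr j (List.nodup_finRange n),
    Finset.sum_eq_zero]
  · split_ifs <;> omega
  · intro X _
    cases hX : ν X with
    | none => rfl
    | some m =>
      rw [Option.elim_some, h.rhs_named hX, List.count_eq_zero, ruleWord]
      simp [h.hash_notMem hr, dollar_ne_hash.symm]

theorem sum_count_dollar_le (h : Snapshot e c H ν E) (hr : Descends c r) {X : N} (hX : ν X ≠ none) :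
    ∑ m, (H.rhs m).count (dollar e X) ≤ 1 := by
  classical
  have hl : ∀ a, (letterWord E a).count (dollar e X) = 0 := fun a =>
    List.count_eq_zero.2 fun hm => hX (h.unnamed_of_dollar_mem hr hm)
  rw [h.sum_eq, h.rhs_start, List.count_eq_zero.2 (h.dollar_notMem_startWord hr hX _), zero_add]
  refine le_trans (Finset.sum_le_sum (g := fun Y => if Y = X then 1 else 0) fun Y _ => ?_) (by simp)
  cases hY : ν Y with
  | none => simp
  | some m =>
    rw [Option.elim_some, h.rhs_named hY, ruleWord]
    simp [List.count_cons, hl, dollar_inj]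

/-- Every repeated string lies inside the current form of the expansion of some nonterminal `Z`
that has not been named yet, and contains the separator of `Z`. -/
theorem exists_infix_of_two_le_rhsOccs (h : Snapshot e c H ν E) (hr : Descends c r)
    {p : List (M ⊕ (T ⊕ Fin n ⊕ Fin (2 * n)))} (hp : 2 ≤ p.length) (hocc : 2 ≤ H.rhsOccs p) :
    ∃ Z, ν Z = none ∧ dollar e Z ∈ p ∧ p <:+: E Z := by
  have hle : ∀ {x}, x ∈ p → 2 ≤ ∑ m, (H.rhs m).count x := fun hx =>
    hocc.trans (Finset.sum_le_sum fun m _ => greedyCount_le_count hx _)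
  have hh : ∀ j, hash j ∉ p := fun j hj => by
    have := hle hj
    have := h.sum_count_hash_le hr j
    omega
  have hd : ∀ {X}, ν X ≠ none → dollar e X ∉ p := fun hX hXp => by
    have := hle hXp
    have := h.sum_count_dollar_le hr hX
    omega
  rw [rhsOccs, h.sum_eq, h.rhs_start] at hocc
  by_cases hs : 0 < greedyCount p (startWord e E (List.finRange n))
  · exact h.infix_of_infix_startWord hr hp hh (infix_of_greedyCount_pos hs)
  · obtain ⟨X, -, hX⟩ := Finset.exists_ne_zero_of_sum_ne_zero
      (show ∑ X, (ν X).elim 0 (fun m => greedyCount p (H.rhs m)) ≠ 0 by omega)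
    cases hνX : ν X with
    | none => simp [hνX] at hX
    | some m =>
      rw [hνX, Option.elim_some, h.rhs_named hνX] at hX
      exact (List.infix_append_cons_of_notMem (hd (by simp [hνX]))
        (infix_of_greedyCount_pos (Nat.pos_of_ne_zero hX))).elim
        (h.infix_of_infix_letterWord hr hp) (h.infix_of_infix_letterWord hr hp)

theorem exists_eq_of_isMaximal (h : Snapshot e c H ν E) (hr : Descends c r)
    {s : List (M ⊕ (T ⊕ Fin n ⊕ Fin (2 * n)))} (hs : H.IsMaximal s) :
    ∃ Z, ν Z = none ∧ s = E Z := by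
  obtain ⟨hlen, hocc, hmax⟩ := hs
  obtain ⟨Z, hZ, hZs, hsZ⟩ := h.exists_infix_of_two_le_rhsOccs hr hlen hocc
  refine ⟨Z, hZ, hsZ.eq_of_length_le ?_⟩
  by_contra! hlt
  have h₁ : H.rhsOccs s ≤ ∑ m, (H.rhs m).count (dollar e Z) :=
    Finset.sum_le_sum fun m _ => greedyCount_le_count hZs _
  have h₂ := h.sum_count_dollar_le_rhsOccs hr hZ
  have h₃ := hmax _ hlt
  omega

theorem exists_isMaximal (h : Snapshot e c H ν E) (hr : Descends c r) {X : N} (hX : ν X = none) :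
    ∃ s, H.IsMaximal s := by
  classical
  obtain ⟨Z, hZ, hmax⟩ := Finset.exists_max_image (Finset.univ.filter fun X => ν X = none)
    (fun X => (E X).length) ⟨X, by simpa using hX⟩
  simp only [Finset.mem_filter, Finset.mem_univ, true_and] at hZ hmax
  refine ⟨E Z, h.two_le_length hZ, h.two_le_rhsOccs hr hZ, fun s hs => ?_⟩
  by_contra! hle
  have hZocc := h.two_le_rhsOccs hr hZ
  obtain ⟨Y, hY, -, hsY⟩ := h.exists_infix_of_two_le_rhsOccs hr (p := s)
    (by have := h.two_le_length hZ; omega) (by omega)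
  have := hmax Y hY
  have := hsY.length_le
  omega

theorem greedyReplace_startWord (h : Snapshot e c H ν E) (hr : Descends c r) (Z : N) (L : List (Fin n)) :
    greedyReplace (E Z) (Sum.inl none) (Sum.map some id) (startWord e E L) =
      startWord e (fun X => greedyReplace (E Z) (Sum.inl none) (Sum.map some id) (E X)) L := by
  induction L with
  | nil => simp [startWord, greedyReplace]
  | cons i L ih =>
    have hh : ∀ j, hash j ∉ E Z := fun j => h.hash_notMem hr j (Sum.inl Z)
    rw [startWord_cons, startWord_cons, greedyReplace_append_cons _ _ (hh _),
      greedyReplace_append_cons _ _ (hh _), ih]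
    rfl

theorem globalStep [DecidableEq N] (h : Snapshot e c H ν E) (hr : Descends c r) {Z : N} (hZ : ν Z = none) :
    Snapshot e c (H.globalStep (E Z))
      (Function.update (fun X => (ν X).map some) Z (some none))
      (fun X => greedyReplace (E Z) (Sum.inl none) (Sum.map some id) (E X)) := by
  have hletter : ∀ a, letterWord
      (fun X => greedyReplace (E Z) (Sum.inl none) (Sum.map some id) (E X)) a =
      greedyReplace (E Z) (Sum.inl none) (Sum.map some id) (letterWord E a) := by
    rintro (X | t)
    · rfl
    · simp [letterWord, symWord, greedyReplace_singleton (h.two_le_length hZ)]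
  have hrule : ∀ X, X ≠ Z ∨ ν X ≠ none → ruleWord e c
      (fun X => greedyReplace (E Z) (Sum.inl none) (Sum.map some id) (E X)) X =
      greedyReplace (E Z) (Sum.inl none) (Sum.map some id) (ruleWord e c E X) := fun X hX => by
    rw [h.greedyReplace_ruleWord hr _ _ hZ hX, ruleWord, hletter, hletter]
    rfl
  refine ⟨fun {X m} hX => ?_, fun {X} hX => ?_, ?_, fun {X m} hX => ?_, fun F => ?_⟩
  · by_cases hXZ : X = Z
    · subst hXZ
      rw [Function.update_self] at hX
      cases hX
      exact greedyReplace_self (h.ne_nil X) _ _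
    · rw [Function.update_of_ne hXZ, Option.map_eq_some_iff] at hX
      obtain ⟨m, hX, rfl⟩ := hX
      rw [h.named hX, greedyReplace_singleton (h.two_le_length hZ)]
      rfl
  · by_cases hXZ : X = Z
    · subst hXZ
      simp at hX
    · rw [Function.update_of_ne hXZ, Option.map_eq_none_iff] at hX
      rw [hrule X (Or.inl hXZ), ← h.unnamed hX]
  · change greedyReplace _ _ _ (H.rhs H.start) = _
    rw [h.rhs_start, h.greedyReplace_startWord hr]
  · by_cases hXZ : X = Z
    · subst hXZ
      rw [Function.update_self] at hX
      cases hX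
      have hc := h.dollar_notMem_children hr X
      change (E X).map _ = _
      rw [ruleWord, hletter, hletter, greedyReplace_of_notMem (h.dollar_mem hZ) hc.1,
        greedyReplace_of_notMem (h.dollar_mem hZ) hc.2]
      conv_lhs => rw [h.unnamed hZ, ruleWord, List.map_append, List.map_cons]
      rfl
    · rw [Function.update_of_ne hXZ, Option.map_eq_some_iff] at hX
      obtain ⟨m, hX, rfl⟩ := hX
      change greedyReplace _ _ _ (H.rhs m) = _
      rw [hrule X (Or.inl hXZ), h.rhs_named hX]
  · have hsum : ∀ X, (Function.update (fun X => (ν X).map some) Z (some none) X).elim 0 F =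
        (if X = Z then F none else 0) + (ν X).elim 0 (fun m => F (some m)) := fun X => by
      by_cases hXZ : X = Z
      · subst hXZ
        simp [hZ]
      · rw [Function.update_of_ne hXZ, if_neg hXZ, zero_add]
        cases ν X <;> rfl
    rw [Fintype.sum_option, h.sum_eq, Finset.sum_congr rfl fun X _ => hsum X,
      Finset.sum_add_distrib, Finset.sum_ite_eq' Finset.univ Z, if_pos (Finset.mem_univ Z)]
    change _ = F (some H.start) + _
    omega

end Snapshot

end Snapshot

end SLG

theorem IsGlobalRun.exists_snapshot {T N : Type} [DecidableEq T] [Fintype N] {n : ℕ}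
    {e : Fin n ≃ N} {c : N → (N ⊕ T) × (N ⊕ T)} {r : N → ℕ} (hr : SLG.Descends c r)
    {D : N → List (T ⊕ Fin n)}
    (hD : ∀ X, D X = SLG.symWord D Sum.inl (c X).1 ++
      Sum.inr (e.symm X) :: SLG.symWord D Sum.inl (c X).2)
    {K : ℕ} {Gs : (k : ℕ) → SLG (T ⊕ Fin n ⊕ Fin (2 * n)) (Fin (k + 1))}
    (hrun : IsGlobalRun (alphaWord e D) K Gs) {k : ℕ} (hk : k ≤ K) :
    ∃ ν E, SLG.Snapshot e c (Gs k) ν E := by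
  classical
  induction k with
  | zero =>
    rw [hrun.1]
    exact ⟨_, _, SLG.Snapshot.initSLG hD⟩
  | succ k ih =>
    obtain ⟨ν, E, h⟩ := ih (by omega)
    obtain ⟨s, hs, hstep⟩ := hrun.2 k (by omega)
    obtain ⟨Z, hZ, rfl⟩ := h.exists_eq_of_isMaximal hr hs
    rw [hstep]
    exact ⟨_, _, (h.globalStep hr hZ).relabel _⟩

/-- Every global algorithm with the string `w ∈ α(G)` as input outputs
a grammar of size exactly `(7/2)·|G| = 7·|V|`: every terminating run of a global
algorithm on `w` ends with a grammar of size `7·|V|`, equivalently of size `(7/2)·|G|`. -/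
theorem global_output_size {T N : Type} [DecidableEq T] [Fintype N] {n : ℕ}
    (e : Fin n ≃ N) (G : SLG T N) (hG : G.Admissible)
    (expn : N → List T) (hexpn : ∀ X, G.IsExp X (expn X))
    (hord : ∀ i j : Fin n, i ≤ j → (expn (e i)).length ≤ (expn (e j)).length)
    (expD : N → List (T ⊕ Fin n)) (hexpD : ∀ X, (G.primed e).IsExp X (expD X))
    (K : ℕ) (Gs : (k : ℕ) → SLG (T ⊕ Fin n ⊕ Fin (2 * n)) (Fin (k + 1)))
    (hrun : IsGlobalRun (alphaWord e expD) K Gs)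
    (hterm : ∀ s, ¬ (Gs K).IsMaximal s) :
    (Gs K).size = 7 * n ∧ 2 * (Gs K).size = 7 * G.size := by
  have hpair : ∀ X, ∃ p : (N ⊕ T) × (N ⊕ T), G.rhs X = [p.1, p.2] := fun X => by
    obtain ⟨a, b, hab⟩ := List.length_eq_two.1 (hG.1 X)
    exact ⟨(a, b), hab⟩
  choose c hc using hpair
  have hD := fun X => SLG.IsExp.primed_eq hexpD (hc X)
  have hr : SLG.Descends c fun X => (expD X).length := fun X Y hXY => by
    have h := congrArg List.length (hD X)
    simp only [List.length_append, List.length_cons] at h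
    change (expD Y).length < (expD X).length
    rcases hXY with hXY | hXY <;> rw [hXY] at h <;> simp only [SLG.symWord, Sum.elim_inl] at h <;>
      omega
  obtain ⟨ν, E, h⟩ := hrun.exists_snapshot hr hD le_rfl
  have hsize : (Gs K).size = 7 * n := h.size_eq fun X hX => by
    obtain ⟨s, hs⟩ := h.exists_isMaximal hr hX
    exact hterm s hs
  have hGsize : G.size = 2 * n := by
    have hcard : Fintype.card N = n := by simpa using (Fintype.card_congr e).symm
    simp [SLG.size, hG.1, hcard, mul_comm]
  exact ⟨hsize, by omega⟩
end

section
/- Let G = (V, Σ, R, S) be an admissible SLG, let w ∈ β(G), and let (N_i)_{i ∈ [1..|V|]} and G' = (V', Σ', R', S') be the ordering and the SLG corresponding to w in the definition of β(G). Then: (1) for every i ∈ [1..|V|], letting A, B be such that N_i → AB is the rule of N_i in G, it holds |exp_{G'}(N_{i,1})| = 3|exp_G(A)| − 1, |exp_{G'}(N_{i,2})| = 3|exp_G(B)| − 1, and |exp_{G'}(N_{i,0})| = 3|exp_G(N_i)| − 2; and (2) |w| = 6 · Σ_{X ∈ V} |exp_G(X)| − 4|V|. -/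
section Beta

variable {T N : Type} {n : ℕ}

/-- Embedding of a symbol of `G` as a symbol of the auxiliary grammar `G'` of the
`β`-construction: the nonterminal `N_j` becomes `N_{j,0}` and terminals stay terminals.
The nonterminals of `G'` are `Option (Fin n × Fin 3)`, where `some (i, b)` is `N_{i+1,b}`
and `none` is the start symbol `S'`; its terminal alphabet is
`Σ' = Σ ∪ {$_i : i ∈ [1..2|V|]}`, modelled as `T ⊕ Fin (2n)`. -/
def betaSym (e : Fin n ≃ N) : (N ⊕ T) → (Option (Fin n × Fin 3)) ⊕ (T ⊕ Fin (2 * n))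
  | Sum.inl X => Sum.inl (some (e.symm X, 0))
  | Sum.inr t => Sum.inr (Sum.inl t)

/-- The auxiliary grammar `G'` of the `β`-construction: for each rule `N_i → A B` of `G`
it has the rules `N_{i,1} → A' $_{2i-1}`, `N_{i,2} → B' $_{2i}` (where `A'`, `B'` are the
`betaSym`-images of `A`, `B`), `N_{i,0} → N_{i,1} N_{i,2}`, and
`S' → ⨀_{i=1..|V|} N_{i,1} N_{i,2} N_{i,0}`. -/
def Gbeta (G : SLG T N) (e : Fin n ≃ N) :
    SLG (T ⊕ Fin (2 * n)) (Option (Fin n × Fin 3)) where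
  start := none
  rhs := fun
    | none => (List.finRange n).flatMap fun i =>
        [Sum.inl (some (i, 1)), Sum.inl (some (i, 2)), Sum.inl (some (i, 0))]
    | some (i, b) =>
      if b = 0 then [Sum.inl (some (i, 1)), Sum.inl (some (i, 2))]
      else if b = 1 then
        match G.rhs (e i) with
        | [A, _] =>
            [betaSym e A,
             Sum.inr (Sum.inr (⟨2 * i.val, by have := i.isLt; omega⟩ : Fin (2 * n)))]
        | _ => []
      else
        match G.rhs (e i) with
        | [_, B] =>
            [betaSym e B,
             Sum.inr (Sum.inr (⟨2 * i.val + 1, by have := i.isLt; omega⟩ : Fin (2 * n)))]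
        | _ => []

/-- The string `w ∈ β(G)` determined by the ordering `e` and the `G'`-expansions `expB`:
`w = ⨀_{i=1..|V|} exp_{G'}(N_{i,0}) · exp_{G'}(N_{i,0})`. -/
def betaWord (expB : Option (Fin n × Fin 3) → List (T ⊕ Fin (2 * n))) :
    List (T ⊕ Fin (2 * n)) :=
  (List.finRange n).flatMap fun i => expB (some (i, 0)) ++ expB (some (i, 0))

end Beta

namespace SLG

variable {T N : Type}

/-- Big-step expansion of a sentential form into a terminal string. -/
inductive Expands (G : SLG T N) : List (N ⊕ T) → List T → Prop
  | nil : Expands G [] []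
  | terminal (t : T) {l : List (N ⊕ T)} {u : List T} :
      Expands G l u → Expands G (Sum.inr t :: l) (t :: u)
  | nonterminal (X : N) {l : List (N ⊕ T)} {u v : List T} :
      Expands G (G.rhs X) u → Expands G l v → Expands G (Sum.inl X :: l) (u ++ v)

namespace Expands

variable {G : SLG T N}

theorem map_inr (G : SLG T N) (u : List T) : G.Expands (u.map Sum.inr) u := by
  induction u with
  | nil => exact nil
  | cons t u ih => exact terminal t ih

theorem append {l m : List (N ⊕ T)} {u v : List T} (h : G.Expands l u)
    (h' : G.Expands m v) : G.Expands (l ++ m) (u ++ v) := by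
  induction h with
  | nil => exact h'
  | terminal t _ ih => exact terminal t ih
  | nonterminal X hX _ _ ih =>
    rw [List.append_assoc]
    exact nonterminal X hX ih

theorem exists_of_append {l m : List (N ⊕ T)} {w : List T} (h : G.Expands (l ++ m) w) :
    ∃ u v, w = u ++ v ∧ G.Expands l u ∧ G.Expands m v := by
  induction l generalizing w with
  | nil => exact ⟨[], w, rfl, nil, h⟩
  | cons a l ih =>
    cases h with
    | terminal t h =>
      obtain ⟨u, v, rfl, hu, hv⟩ := ih h
      exact ⟨t :: u, v, rfl, terminal t hu, hv⟩
    | nonterminal X hX h =>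
      obtain ⟨u, v, rfl, hu, hv⟩ := ih h
      exact ⟨_, v, (List.append_assoc _ _ _).symm, nonterminal X hX hu, hv⟩

theorem unique {l : List (N ⊕ T)} {u v : List T} (h : G.Expands l u)
    (h' : G.Expands l v) : u = v := by
  induction h generalizing v with
  | nil => cases h'; rfl
  | terminal t _ ih =>
    cases h' with
    | terminal _ h => rw [ih h]
  | nonterminal X _ _ ihX ih =>
    cases h' with
    | nonterminal _ hX h => rw [ihX hX, ih h]

theorem rhs_of_singleton {X : N} {u : List T} (h : G.Expands [Sum.inl X] u) :
    G.Expands (G.rhs X) u := by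
  cases h with
  | nonterminal _ hX h =>
    cases h
    simpa using hX

end Expands

theorem Derives.expands {G : SLG T N} {l : List (N ⊕ T)} {u : List T}
    (h : G.Derives l (u.map Sum.inr)) : G.Expands l u := by
  refine Relation.ReflTransGen.head_induction_on h (Expands.map_inr G u) ?_
  rintro _ _ ⟨p, q, X, rfl, rfl⟩ - ih
  obtain ⟨_, z, rfl, hpx, hz⟩ := ih.exists_of_append
  obtain ⟨x, y, rfl, hx, hy⟩ := hpx.exists_of_append
  rw [List.append_assoc]
  exact hx.append (.nonterminal X hy hz)

/-- The length of the expansion of a symbol, given the expansions of the nonterminals. -/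
def symLength (f : N → List T) : N ⊕ T → ℕ :=
  Sum.elim (fun X => (f X).length) (fun _ => 1)

theorem Expands.length_eq {G : SLG T N} {f : N → List T} (hf : ∀ X, G.IsExp X (f X))
    {l : List (N ⊕ T)} {u : List T} (h : G.Expands l u) :
    u.length = (l.map (symLength f)).sum := by
  induction h with
  | nil => rfl
  | terminal t _ ih => simp [symLength, ih, Nat.add_comm]
  | nonterminal X hX _ _ ih =>
    have := hX.unique (Derives.expands (hf X)).rhs_of_singleton
    simp [symLength, ih, this]

theorem length_eq_sum_rhs {G : SLG T N} {f : N → List T} (hf : ∀ X, G.IsExp X (f X))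
    (X : N) : (f X).length = ((G.rhs X).map (symLength f)).sum :=
  (Derives.expands (hf X)).rhs_of_singleton.length_eq hf

/-- Induction along the parse trees of a grammar in which every nonterminal has an
expansion. -/
theorem induction_on_rhs {G : SLG T N} {f : N → List T} (hf : ∀ X, G.IsExp X (f X))
    {P : N → Prop} (step : ∀ X, (∀ Y, Sum.inl Y ∈ G.rhs X → P Y) → P X) (X : N) : P X := by
  have key : ∀ l u, G.Expands l u → ∀ Y, Sum.inl Y ∈ l → P Y := by
    intro l u h
    induction h with
    | nil => simp
    | terminal t _ ih => simpa using ih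
    | nonterminal X _ _ ihX ih =>
      intro Y hY
      rcases List.mem_cons.1 hY with hY | hY
      · cases hY
        exact step X ihX
      · exact ih Y hY
  exact key _ _ (Derives.expands (hf X)) X (by simp)

end SLG

section Beta

open SLG

variable {T N : Type} {n : ℕ} {e : Fin n ≃ N} {G : SLG T N}
  {expB : Option (Fin n × Fin 3) → List (T ⊕ Fin (2 * n))}

theorem length_expB_zero (hexpB : ∀ X, (Gbeta G e).IsExp X (expB X)) (i : Fin n) :
    (expB (some (i, 0))).length =
      (expB (some (i, 1))).length + (expB (some (i, 2))).length := by
  simpa [Gbeta, symLength] using length_eq_sum_rhs hexpB (some (i, 0))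

theorem length_expB_one (hexpB : ∀ X, (Gbeta G e).IsExp X (expB X)) {i : Fin n}
    {A B : N ⊕ T} (h : G.rhs (e i) = [A, B]) :
    (expB (some (i, 1))).length = symLength expB (betaSym e A) + 1 := by
  have := length_eq_sum_rhs hexpB (some (i, 1))
  simp only [Gbeta, h] at this
  simpa [symLength] using this

theorem length_expB_two (hexpB : ∀ X, (Gbeta G e).IsExp X (expB X)) {i : Fin n}
    {A B : N ⊕ T} (h : G.rhs (e i) = [A, B]) :
    (expB (some (i, 2))).length = symLength expB (betaSym e B) + 1 := by
  have := length_eq_sum_rhs hexpB (some (i, 2))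
  simp only [Gbeta, h] at this
  simpa [symLength] using this

theorem symLength_betaSym {expn : N → List T} {A : N ⊕ T}
    (h : ∀ Y, A = Sum.inl Y →
      (expB (some (e.symm Y, 0))).length + 2 = 3 * (expn Y).length) :
    symLength expB (betaSym e A) + 2 = 3 * symLength expn A := by
  cases A with
  | inl Y => exact h Y rfl
  | inr t => rfl

theorem length_expB_symm (hG : G.Admissible) {expn : N → List T}
    (hexpn : ∀ X, G.IsExp X (expn X)) (hexpB : ∀ X, (Gbeta G e).IsExp X (expB X)) (X : N) :
    (expB (some (e.symm X, 0))).length + 2 = 3 * (expn X).length := by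
  refine induction_on_rhs hexpn
    (P := fun X => (expB (some (e.symm X, 0))).length + 2 = 3 * (expn X).length)
    (fun X ih => ?_) X
  obtain ⟨A, B, hAB⟩ := List.length_eq_two.1 (hG.1 X)
  have hAB' : G.rhs (e (e.symm X)) = [A, B] := by simpa using hAB
  have hA := symLength_betaSym (A := A) fun Y hY => ih Y (by simp [hAB, hY])
  have hB := symLength_betaSym (A := B) fun Y hY => ih Y (by simp [hAB, hY])
  have h0 := length_expB_zero hexpB (e.symm X)
  have h1 := length_expB_one hexpB hAB'
  have h2 := length_expB_two hexpB hAB'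
  have hX := length_eq_sum_rhs hexpn X
  simp only [hAB, List.map_cons, List.map_nil, List.sum_cons, List.sum_nil] at hX
  omega

theorem length_betaWord (expB : Option (Fin n × Fin 3) → List (T ⊕ Fin (2 * n))) :
    (betaWord expB).length = ∑ i : Fin n, 2 * (expB (some (i, 0))).length := by
  simp [betaWord, List.length_flatMap, two_mul, ← List.ofFn_eq_map, List.sum_ofFn]

end Beta

/-- Let `G` be an admissible SLG, `w ∈ β(G)`, with ordering
`(N_i)` and auxiliary SLG `G'` as in the definition of `β(G)`.  Then: (1) for every `i`,
if `N_i → A B` in `G` then `|exp_{G'}(N_{i,1})| = 3|exp_G(A)| − 1`,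
`|exp_{G'}(N_{i,2})| = 3|exp_G(B)| − 1` and `|exp_{G'}(N_{i,0})| = 3|exp_G(N_i)| − 2`
(stated additively); and (2) `|w| = 6·Σ_{X ∈ V} |exp_G(X)| − 4|V|` (stated additively). -/
theorem beta_length {T N : Type} [Fintype N] {n : ℕ} (e : Fin n ≃ N)
    (G : SLG T N) (hG : G.Admissible)
    (expn : N → List T) (hexpn : ∀ X, G.IsExp X (expn X))
    (hord : ∀ i j : Fin n, i ≤ j → (expn (e i)).length ≤ (expn (e j)).length)
    (expB : Option (Fin n × Fin 3) → List (T ⊕ Fin (2 * n)))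
    (hexpB : ∀ X, (Gbeta G e).IsExp X (expB X)) :
    (∀ (i : Fin n) (A B : N ⊕ T), G.rhs (e i) = [A, B] →
      (expB (some (i, 1))).length + 1 =
        3 * Sum.elim (fun X => (expn X).length) (fun _ => 1) A ∧
      (expB (some (i, 2))).length + 1 =
        3 * Sum.elim (fun X => (expn X).length) (fun _ => 1) B ∧
      (expB (some (i, 0))).length + 2 = 3 * (expn (e i)).length) ∧
    (betaWord expB).length + 4 * n = 6 * ∑ X : N, (expn X).length := by
  have key := length_expB_symm hG hexpn hexpB
  refine ⟨fun i A B hAB => ⟨?_, ?_, ?_⟩, ?_⟩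
  · have hA := symLength_betaSym (A := A) fun Y _ => key Y
    have h1 := length_expB_one hexpB hAB
    simp only [SLG.symLength] at hA h1
    omega
  · have hB := symLength_betaSym (A := B) fun Y _ => key Y
    have h2 := length_expB_two hexpB hAB
    simp only [SLG.symLength] at hB h2
    omega
  · simpa using key (e i)
  · have h : ∀ i : Fin n, 2 * (expB (some (i, 0))).length + 4 = 6 * (expn (e i)).length := by
      intro i
      have := key (e i)
      rw [e.symm_apply_apply] at this
      omega
    calc (betaWord expB).length + 4 * n
        = ∑ i : Fin n, (2 * (expB (some (i, 0))).length + 4) := by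
          rw [length_betaWord, Finset.sum_add_distrib]
          simp [mul_comm]
      _ = 6 * ∑ i : Fin n, (expn (e i)).length := by
          rw [Finset.mul_sum]
          exact Finset.sum_congr rfl fun i _ => h i
      _ = 6 * ∑ X : N, (expn X).length := by
          rw [Equiv.sum_comp e fun X => (expn X).length]
end

section
/- Let w : Σ → ℤ_{>0} and let u = x a y b z, where x, y, z ∈ Σ* and a, b ∈ Σ. Assume match(a) = b, that a and b do not occur in x, y, or z, and that w(a) > Σ_{i=1}^{|y|} w(y[i]). Then WRNA(u) = w(a) + WRNA(xz) + WRNA(y). -/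
/-- `R` is a valid RNA-folding set of pairs for the string `u` (0-indexed positions):
every pair `(i, j) ∈ R` satisfies `i < j < |u|` and `match(u[i]) = u[j]`, and `R`
contains no two crossing pairs (two pairs cross if their intervals are neither disjoint
nor properly nested). -/
def RNAValid {A : Type} [Inhabited A] (mtch : A → A) (u : List A)
    (R : Finset (ℕ × ℕ)) : Prop :=
  (∀ pr ∈ R, pr.1 < pr.2 ∧ pr.2 < u.length ∧
    mtch (u.getD pr.1 default) = u.getD pr.2 default) ∧
  ∀ pr ∈ R, ∀ qr ∈ R, pr ≠ qr →
    (pr.2 < qr.1 ∨ qr.2 < pr.1 ∨ (pr.1 < qr.1 ∧ qr.2 < pr.2) ∨ (qr.1 < pr.1 ∧ pr.2 < qr.2))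

/-- The value `WRNA(u)` of the Weighted RNA Folding problem: the largest value of
`Σ_{(i,j) ∈ R} w(u[i])` over all valid sets `R`. -/
noncomputable def WRNA {A : Type} [Inhabited A] (mtch : A → A) (w : A → ℕ)
    (u : List A) : ℕ :=
  sSup { v : ℕ | ∃ R : Finset (ℕ × ℕ), RNAValid mtch u R ∧
    v = ∑ pr ∈ R, w (u.getD pr.1 default) }

section

variable {A : Type} [Inhabited A] {mtch : A → A}

theorem RNAValid.subset {u : List A} {R S : Finset (ℕ × ℕ)} (hR : RNAValid mtch u R)
    (hS : S ⊆ R) : RNAValid mtch u S :=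
  ⟨fun pr h => hR.1 pr (hS h), fun pr h qr h' => hR.2 pr (hS h) qr (hS h')⟩

/-- Two pairs of a valid set which share a position are equal. -/
theorem RNAValid.eq_of_shared {u : List A} {R : Finset (ℕ × ℕ)} (hR : RNAValid mtch u R)
    {pr qr : ℕ × ℕ} (hp : pr ∈ R) (hq : qr ∈ R)
    (h : pr.1 = qr.1 ∨ pr.1 = qr.2 ∨ pr.2 = qr.1 ∨ pr.2 = qr.2) : pr = qr := by
  by_contra hne
  have h1 := hR.2 pr hp qr hq hne
  have h2 := (hR.1 pr hp).1
  have h3 := (hR.1 qr hq).1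
  omega

theorem bddAbove_rnaValid_weights (mtch : A → A) (w : A → ℕ) (u : List A) :
    BddAbove { v : ℕ | ∃ R : Finset (ℕ × ℕ), RNAValid mtch u R ∧
      v = ∑ pr ∈ R, w (u.getD pr.1 default) } := by
  refine ⟨∑ pr ∈ Finset.range u.length ×ˢ Finset.range u.length, w (u.getD pr.1 default), ?_⟩
  rintro v ⟨R, hR, rfl⟩
  refine Finset.sum_le_sum_of_subset fun pr h => ?_
  have := hR.1 pr h
  simp only [Finset.mem_product, Finset.mem_range]
  omega

theorem RNAValid.sum_le_WRNA {u : List A} {R : Finset (ℕ × ℕ)} (hR : RNAValid mtch u R)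
    (w : A → ℕ) : ∑ pr ∈ R, w (u.getD pr.1 default) ≤ WRNA mtch w u :=
  le_csSup (bddAbove_rnaValid_weights mtch w u) ⟨R, hR, rfl⟩

theorem exists_rnaValid_sum_eq_WRNA (mtch : A → A) (w : A → ℕ) (u : List A) :
    ∃ R : Finset (ℕ × ℕ), RNAValid mtch u R ∧
      ∑ pr ∈ R, w (u.getD pr.1 default) = WRNA mtch w u := by
  obtain ⟨R, hR, h⟩ := Nat.sSup_mem (s := { v : ℕ | ∃ R : Finset (ℕ × ℕ), RNAValid mtch u R ∧
      v = ∑ pr ∈ R, w (u.getD pr.1 default) }) ⟨0, ∅, by simp [RNAValid], by simp⟩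
      (bddAbove_rnaValid_weights mtch w u)
  exact ⟨R, hR, h.symm⟩

/-- `f` embeds `v` into `u` as the subsequence at the positions `f 0 < f 1 < ⋯`. -/
structure IsSubseqEmbedding (f : ℕ → ℕ) (v u : List A) : Prop where
  strictMono : StrictMono f
  lt_length : ∀ i < v.length, f i < u.length
  getD_eq : ∀ i < v.length, u.getD (f i) default = v.getD i default

theorem IsSubseqEmbedding.rnaValid_image {f : ℕ → ℕ} {v u : List A}
    (hf : IsSubseqEmbedding f v u) {R : Finset (ℕ × ℕ)} (hR : RNAValid mtch v R) :
    RNAValid mtch u (R.image (Prod.map f f)) := by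
  constructor
  · intro pr hpr
    obtain ⟨qr, hq, rfl⟩ := Finset.mem_image.1 hpr
    obtain ⟨h1, h2, h3⟩ := hR.1 qr hq
    refine ⟨hf.strictMono h1, hf.lt_length _ h2, ?_⟩
    simp only [Prod.map_fst, Prod.map_snd]
    rw [hf.getD_eq _ h2, hf.getD_eq _ (h1.trans h2), h3]
  · intro pr hpr qr hqr hne
    obtain ⟨pr, hp, rfl⟩ := Finset.mem_image.1 hpr
    obtain ⟨qr, hq, rfl⟩ := Finset.mem_image.1 hqr
    simpa only [Prod.map_fst, Prod.map_snd, hf.strictMono.lt_iff_lt] using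
      hR.2 pr hp qr hq (by rintro rfl; exact hne rfl)

theorem IsSubseqEmbedding.sum_image {f : ℕ → ℕ} {v u : List A}
    (hf : IsSubseqEmbedding f v u) (w : A → ℕ) {R : Finset (ℕ × ℕ)} (hR : RNAValid mtch v R) :
    ∑ pr ∈ R.image (Prod.map f f), w (u.getD pr.1 default) =
      ∑ pr ∈ R, w (v.getD pr.1 default) := by
  have hinj := hf.strictMono.injective
  rw [Finset.sum_image (hinj.prodMap hinj).injOn]
  refine Finset.sum_congr rfl fun pr h => ?_
  obtain ⟨h1, h2, -⟩ := hR.1 pr h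
  rw [Prod.map_fst, hf.getD_eq _ (h1.trans h2)]

theorem IsSubseqEmbedding.sum_le_WRNA {f : ℕ → ℕ} {v u : List A}
    (hf : IsSubseqEmbedding f v u) (w : A → ℕ) {R : Finset (ℕ × ℕ)} (hR : RNAValid mtch u R)
    (hr : ∀ pr ∈ R, (∃ i < v.length, f i = pr.1) ∧ ∃ j < v.length, f j = pr.2) :
    ∑ pr ∈ R, w (u.getD pr.1 default) ≤ WRNA mtch w v := by
  classical
  have hinj := hf.strictMono.injective
  set S := R.preimage (Prod.map f f) (hinj.prodMap hinj).injOn with hS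
  have himg : S.image (Prod.map f f) = R := by
    rw [hS, Finset.image_preimage]
    refine Finset.filter_true_of_mem fun pr h => ?_
    obtain ⟨⟨i, -, hi⟩, j, -, hj⟩ := hr pr h
    exact ⟨(i, j), Prod.ext hi hj⟩
  have hSv : RNAValid mtch v S := by
    constructor
    · intro pr hpr
      have hmem : Prod.map f f pr ∈ R := Finset.mem_preimage.1 hpr
      obtain ⟨h1, h2, h3⟩ := hR.1 _ hmem
      obtain ⟨⟨i, hi, hi'⟩, j, hj, hj'⟩ := hr _ hmem
      obtain rfl := hinj hi'
      obtain rfl := hinj hj'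
      rw [Prod.map_fst, Prod.map_snd, hf.getD_eq _ hi, hf.getD_eq _ hj] at h3
      exact ⟨hf.strictMono.lt_iff_lt.1 h1, hj, h3⟩
    · intro pr hpr qr hqr hne
      simpa only [Prod.map_fst, Prod.map_snd, hf.strictMono.lt_iff_lt] using
        hR.2 _ (Finset.mem_preimage.1 hpr) _ (Finset.mem_preimage.1 hqr)
          ((hinj.prodMap hinj).ne hne)
  rw [← himg, hf.sum_image w hSv]
  exact hSv.sum_le_WRNA w

theorem sum_range_getD_eq_sum_map (w : A → ℕ) (y : List A) :
    ∑ i ∈ Finset.range y.length, w (y.getD i default) = (y.map w).sum := by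
  induction y with
  | nil => simp
  | cons c y ih => simp [Finset.sum_range_succ', ← ih, add_comm]

/-- If every pair of a valid set touches the factor `y` of `u` starting at position `s`, then the
weight of the set is at most the total weight of `y`. -/
theorem RNAValid.sum_le_sum_map {u y : List A} {s : ℕ} (w : A → ℕ)
    (hwm : ∀ c, w (mtch c) = w c)
    (hy : ∀ i < y.length, u.getD (i + s) default = y.getD i default)
    {R : Finset (ℕ × ℕ)} (hR : RNAValid mtch u R)
    (ht : ∀ pr ∈ R, (s ≤ pr.1 ∧ pr.1 < s + y.length) ∨ (s ≤ pr.2 ∧ pr.2 < s + y.length)) :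
    ∑ pr ∈ R, w (u.getD pr.1 default) ≤ (y.map w).sum := by
  classical
  let g : ℕ × ℕ → ℕ := fun pr => if s ≤ pr.1 ∧ pr.1 < s + y.length then pr.1 - s else pr.2 - s
  have hg : ∀ pr ∈ R, g pr < y.length ∧ (g pr + s = pr.1 ∨ g pr + s = pr.2) := by
    intro pr h
    have := ht pr h
    simp only [g]
    split_ifs <;> omega
  have hinj : Set.InjOn g R := by
    intro pr hp qr hq h
    have h1 := (hg pr hp).2
    have h2 := (hg qr hq).2
    exact hR.eq_of_shared hp hq (by omega)
  have hval : ∀ pr ∈ R, w (u.getD pr.1 default) = w (y.getD (g pr) default) := by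
    intro pr h
    obtain ⟨h1, h2⟩ := hg pr h
    rw [← hy _ h1]
    rcases h2 with h2 | h2
    · rw [h2]
    · rw [h2, ← (hR.1 pr h).2.2, hwm]
  rw [Finset.sum_congr rfl hval, ← Finset.sum_image (f := fun i => w (y.getD i default)) hinj,
    ← sum_range_getD_eq_sum_map]
  refine Finset.sum_le_sum_of_subset fun i hi => ?_
  obtain ⟨pr, h, rfl⟩ := Finset.mem_image.1 hi
  exact Finset.mem_range.2 (hg pr h).1

theorem isSubseqEmbedding_middle (x y z : List A) (a b : A) :
    IsSubseqEmbedding (fun i => i + (x.length + 1)) y (x ++ a :: y ++ b :: z) where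
  strictMono := fun i j h => by simpa using h
  lt_length := fun i hi => by simp; omega
  getD_eq := fun i hi => by
    rw [List.getD_append _ _ _ _ (by simp; omega), List.getD_append_right _ _ _ _ (by omega),
      show i + (x.length + 1) - x.length = i + 1 by omega, List.getD_cons_succ]

theorem isSubseqEmbedding_outer (x y z : List A) (a b : A) :
    IsSubseqEmbedding (fun i => if i < x.length then i else i + (y.length + 2)) (x ++ z)
      (x ++ a :: y ++ b :: z) where
  strictMono := fun i j h => by
    dsimp only
    split_ifs <;> omega
  lt_length := fun i hi => by
    simp only [List.length_append, List.length_cons] at hi ⊢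
    split_ifs <;> omega
  getD_eq := fun i hi => by
    split_ifs with h
    · rw [List.getD_append _ _ _ _ (by simp; omega), List.getD_append _ _ _ _ h,
        List.getD_append _ _ _ _ h]
    · rw [List.getD_append_right _ _ _ _ (by simp; omega),
        List.getD_append_right _ _ _ _ (by omega),
        show i + (y.length + 2) - (x ++ a :: y).length = i - x.length + 1 by simp; omega,
        List.getD_cons_succ]

theorem getD_open (x y z : List A) (a b : A) :
    (x ++ a :: y ++ b :: z).getD x.length default = a := by
  simp

theorem getD_close (x y z : List A) (a b : A) :
    (x ++ a :: y ++ b :: z).getD (x.length + 1 + y.length) default = b := by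
  rw [List.getD_append_right _ _ _ _ (by simp; omega),
    show x.length + 1 + y.length - (x ++ a :: y).length = 0 by simp; omega, List.getD_cons_zero]

theorem eq_open_or_close {x y z : List A} {a b c : A} (hx : c ∉ x) (hy : c ∉ y) (hz : c ∉ z)
    {i : ℕ} (hi : i < (x ++ a :: y ++ b :: z).length)
    (h : (x ++ a :: y ++ b :: z).getD i default = c) :
    i = x.length ∨ i = x.length + 1 + y.length := by
  have hmem : ∀ {l : List A} {k : ℕ}, k < l.length → l.getD k default ∈ l := fun hk => by
    rw [List.getD_eq_getElem _ _ hk]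
    exact List.getElem_mem hk
  by_contra! hne
  simp only [List.length_append, List.length_cons] at hi
  by_cases hin : x.length < i ∧ i < x.length + 1 + y.length
  · have hk : i - (x.length + 1) < y.length := by omega
    have h1 := (isSubseqEmbedding_middle x y z a b).getD_eq _ hk
    rw [show i - (x.length + 1) + (x.length + 1) = i by omega, h] at h1
    exact hy (h1 ▸ hmem hk)
  · have hk : ∃ k < (x ++ z).length, (if k < x.length then k else k + (y.length + 2)) = i := by
      by_cases hlt : i < x.length
      · exact ⟨i, by simp; omega, by simp [hlt]⟩
      · refine ⟨i - (y.length + 2), by simp; omega, ?_⟩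
        split_ifs <;> omega
    obtain ⟨k, hk, rfl⟩ := hk
    have h1 := (isSubseqEmbedding_outer x y z a b).getD_eq k hk
    rw [h] at h1
    have := hmem hk
    rw [← h1, List.mem_append] at this
    exact this.elim hx hz

end

/-- Let `w : Σ → ℤ_{>0}` be a weight function and `u = x a y b z` with
`match(a) = b`, where `a` and `b` occur in none of `x`, `y`, `z` and
`w(a) > Σ_i w(y[i])`.  Then `WRNA(u) = w(a) + WRNA(xz) + WRNA(y)`. -/
theorem wrna_decomposition {A : Type} [Inhabited A]
    (mtch : A → A) (w : A → ℕ)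
    (hm1 : ∀ s, mtch s ≠ s) (hm2 : ∀ s, mtch (mtch s) = s)
    (hw : ∀ s, 0 < w s) (hwm : ∀ s, w (mtch s) = w s)
    (x y z : List A) (a b : A)
    (hab : mtch a = b)
    (hax : a ∉ x) (hay : a ∉ y) (haz : a ∉ z)
    (hbx : b ∉ x) (hby : b ∉ y) (hbz : b ∉ z)
    (hwa : (y.map w).sum < w a) :
    WRNA mtch w (x ++ a :: y ++ b :: z) =
      w a + WRNA mtch w (x ++ z) + WRNA mtch w y := by
  have hmid := isSubseqEmbedding_middle x y z a b
  have hout := isSubseqEmbedding_outer x y z a b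
  set u := x ++ a :: y ++ b :: z with hu
  set p := x.length with hp
  set q := x.length + 1 + y.length with hq
  have hpa : u.getD p default = a := getD_open x y z a b
  have hqb : u.getD q default = b := getD_close x y z a b
  have hne : a ≠ b := fun h => hm1 a (hab.trans h.symm)
  have hba : mtch b = a := by rw [← hab, hm2]
  have hlen : u.length = q + 1 + z.length := by simp [hu, hq]; omega
  apply le_antisymm
  · obtain ⟨R, hR, hsum⟩ := exists_rnaValid_sum_eq_WRNA mtch w u
    rw [← hsum]
    have hposa : ∀ i < u.length, u.getD i default = a → i = p := fun i hi h =>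
      (eq_open_or_close hax hay haz hi h).resolve_right
        fun h' => hne (by rw [← h, ← hqb, h'])
    have hposb : ∀ i < u.length, u.getD i default = b → i = q := fun i hi h =>
      (eq_open_or_close hbx hby hbz hi h).resolve_left
        fun h' => hne (by rw [← h, ← hpa, h'])
    have htouch : ∀ pr ∈ R, pr ≠ (p, q) →
        pr.1 ≠ p ∧ pr.1 ≠ q ∧ pr.2 ≠ p ∧ pr.2 ≠ q := by
      rintro ⟨i, j⟩ h hpq
      obtain ⟨h1, h2, h3⟩ := hR.1 _ h
      dsimp only at h1 h2 h3 ⊢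
      refine ⟨?_, ?_, ?_, ?_⟩ <;> rintro rfl
      · rw [hpa, hab] at h3
        exact hpq (by rw [hposb j h2 h3.symm])
      · rw [hqb, hba] at h3
        have := hposa j h2 h3.symm
        omega
      · rw [hpa, ← hba] at h3
        have := hposb i (h1.trans h2) (by rw [← hm2 (u.getD i default), h3, hm2])
        omega
      · rw [hqb, ← hab] at h3
        exact hpq (by rw [hposa i (h1.trans h2) (by rw [← hm2 (u.getD i default), h3, hm2])])
    obtain ⟨inside, hinside⟩ : ∃ P : ℕ × ℕ → Prop, ∀ pr, P pr ↔
        (p + 1 ≤ pr.1 ∧ pr.1 < p + 1 + y.length) ∨ (p + 1 ≤ pr.2 ∧ pr.2 < p + 1 + y.length) :=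
      ⟨_, fun _ => Iff.rfl⟩
    classical
    have hR' := hR.subset (Finset.erase_subset (p, q) R)
    have houter : ∑ pr ∈ (R.erase (p, q)).filter (fun pr => ¬ inside pr),
        w (u.getD pr.1 default) ≤ WRNA mtch w (x ++ z) := by
      refine hout.sum_le_WRNA w (hR'.subset (Finset.filter_subset _ _)) fun pr h => ?_
      obtain ⟨h, hn⟩ := Finset.mem_filter.1 h
      obtain ⟨hpq, h⟩ := Finset.mem_erase.1 h
      obtain ⟨h1, h2, -⟩ := hR.1 _ h
      obtain ⟨t1, t2, t3, t4⟩ := htouch pr h hpq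
      rw [hinside] at hn
      have key : ∀ i < u.length, i ≠ p → i ≠ q → ¬ (p + 1 ≤ i ∧ i < p + 1 + y.length) →
          ∃ k < (x ++ z).length, (if k < p then k else k + (y.length + 2)) = i := by
        intro i hi hip hiq hin
        by_cases hlt : i < p
        · exact ⟨i, by simp; omega, by simp [hlt]⟩
        · refine ⟨i - (y.length + 2), by simp; omega, ?_⟩
          split_ifs <;> omega
      exact ⟨key _ (h1.trans h2) t1 t2 (by omega), key _ h2 t3 t4 (by omega)⟩
    have hsplit : ∑ pr ∈ (R.erase (p, q)).filter inside, w (u.getD pr.1 default) +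
        ∑ pr ∈ (R.erase (p, q)).filter (fun pr => ¬ inside pr), w (u.getD pr.1 default) =
        ∑ pr ∈ R.erase (p, q), w (u.getD pr.1 default) :=
      Finset.sum_filter_add_sum_filter_not ..
    have hR'' := hR'.subset (Finset.filter_subset inside _)
    by_cases hmem : (p, q) ∈ R
    · have hinner : ∑ pr ∈ (R.erase (p, q)).filter inside,
          w (u.getD pr.1 default) ≤ WRNA mtch w y := by
        refine hmid.sum_le_WRNA w hR'' fun pr h => ?_
        obtain ⟨h, hn⟩ := Finset.mem_filter.1 h
        obtain ⟨hpq, h⟩ := Finset.mem_erase.1 h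
        have h1 := (hR.1 _ h).1
        have h2 := hR.2 pr h _ hmem hpq
        rw [hinside] at hn
        dsimp only at h2
        exact ⟨⟨pr.1 - (p + 1), by omega, by omega⟩, pr.2 - (p + 1), by omega, by omega⟩
      have hadd := Finset.add_sum_erase R (fun pr => w (u.getD pr.1 default)) hmem
      simp only [hpa] at hadd
      omega
    · have hinner := hR''.sum_le_sum_map (y := y) (s := p + 1) w hwm hmid.getD_eq
        fun pr h => (hinside pr).1 (Finset.mem_filter.1 h).2
      rw [Finset.erase_eq_of_notMem hmem] at hsplit hinner houter
      omega
  · obtain ⟨S, hS, hSsum⟩ := exists_rnaValid_sum_eq_WRNA mtch w (x ++ z)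
    obtain ⟨T, hT, hTsum⟩ := exists_rnaValid_sum_eq_WRNA mtch w y
    have hS' := hout.rnaValid_image hS
    have hT' := hmid.rnaValid_image hT
    rw [← hSsum, ← hTsum, ← hout.sum_image w hS, ← hmid.sum_image w hT]
    have hSpos : ∀ pr ∈ S.image (Prod.map (fun i => if i < p then i else i + (y.length + 2))
        (fun i => if i < p then i else i + (y.length + 2))),
        (pr.1 < p ∨ q < pr.1) ∧ (pr.2 < p ∨ q < pr.2) := by
      intro pr h
      obtain ⟨qr, -, rfl⟩ := Finset.mem_image.1 h
      simp only [Prod.map_fst, Prod.map_snd]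
      split_ifs <;> omega
    have hTpos : ∀ pr ∈ T.image (Prod.map (fun i => i + (p + 1)) (fun i => i + (p + 1))),
        p < pr.1 ∧ pr.1 < q ∧ p < pr.2 ∧ pr.2 < q := by
      intro pr h
      obtain ⟨qr, hqr, rfl⟩ := Finset.mem_image.1 h
      have := hT.1 qr hqr
      simp only [Prod.map_fst, Prod.map_snd]
      omega
    set S' := S.image (Prod.map (fun i => if i < p then i else i + (y.length + 2))
      (fun i => if i < p then i else i + (y.length + 2)))
    set T' := T.image (Prod.map (fun i => i + (p + 1)) (fun i => i + (p + 1)))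
    have hdisj : Disjoint S' T' := Finset.disjoint_left.2 fun pr h h' => by
      have := hSpos pr h
      have := hTpos pr h'
      omega
    have hnot : (p, q) ∉ S' ∪ T' := fun h => by
      rcases Finset.mem_union.1 h with h | h
      · have := hSpos _ h
        dsimp only at this
        omega
      · have := hTpos _ h
        dsimp only at this
        omega
    have hval : RNAValid mtch u (insert (p, q) (S' ∪ T')) := by
      constructor
      · intro pr h
        rcases Finset.mem_insert.1 h with rfl | h
        · exact ⟨by dsimp only; omega, by dsimp only; omega, by rw [hpa, hqb, hab]⟩
        · exact (Finset.mem_union.1 h).elim (hS'.1 pr) (hT'.1 pr)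
      · have hcases : ∀ pr ∈ insert (p, q) (S' ∪ T'), pr = (p, q) ∨ pr ∈ S' ∨ pr ∈ T' := by
          simp
        intro pr h qr h' hpq
        rcases hcases pr h with rfl | h | h <;> rcases hcases qr h' with rfl | h' | h'
        · exact absurd rfl hpq
        · have := hSpos _ h'
          have := (hS'.1 _ h').1
          dsimp only
          omega
        · have := hTpos _ h'
          dsimp only
          omega
        · have := hSpos _ h
          have := (hS'.1 _ h).1
          dsimp only
          omega
        · exact hS'.2 _ h _ h' hpq
        · have := hSpos _ h
          have := (hS'.1 _ h).1
          have := hTpos _ h'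
          omega
        · have := hTpos _ h
          dsimp only
          omega
        · have := hSpos _ h'
          have := (hS'.1 _ h').1
          have := hTpos _ h
          omega
        · exact hT'.2 _ h _ h' hpq
    have := hval.sum_le_WRNA w
    rw [Finset.sum_insert hnot, Finset.sum_union hdisj] at this
    simp only [hpa] at this
    omega
end
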